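/- Let 0 < q, r < ∞ and 1 < p < ∞ with r < p ≤ q, let u, w be weights on (0,∞), and let v be a weight on (0,∞) such that ∫₀^x v(t)^{1-p'} dt < ∞ for every x ∈ (0,∞). Then there exists a constant C > 0 such that (∫₀^∞ (∫_x^∞ (∫₀^t h(s) ds)^r u(t) dt)^{q/r} w(x) dx)^{1/q} ≤ C (∫₀^∞ h(t)^p v(t) dt)^{1/p} for all h ∈ M⁺(0,∞) if and only if F₂ < ∞ and F₅ < ∞, where F₂ := sup_{x∈(0,∞)} (∫_x^∞ (∫_t^∞ u)^{q/r} w(t) dt)^{1/q} (∫₀^x v^{1-p'})^{1/p'} and F₅ := sup_{t∈(0,∞)} (∫₀^t w)^{1/q} (∫_t^∞ (∫_x^∞ u)^{r/(p-r)} u(x) (∫₀^x v^{1-p'})^{(p-1)r/(p-r)} dx)^{(p-r)/(pr)}. -/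

import Mathlib

open MeasureTheory Set ENNReal NNReal

noncomputable section

/-- Lebesgue measure restricted to `(0, ∞)`. -/
def mu0 : Measure ℝ := volume.restrict (Ioi (0 : ℝ))

/-- A weight on `(0, ∞)`: a measurable function that is positive (and finite) a.e. on `(0, ∞)`. -/
def IsWeight (v : ℝ → ℝ≥0∞) : Prop :=
  Measurable v ∧ ∀ᵐ x ∂mu0, 0 < v x ∧ v x < ∞

/-- The distribution function of a finite diffuse measure pushes it forward to Lebesgue measure. -/
lemma map_measure_Iic (μ : Measure ℝ) [IsFiniteMeasure μ] (hμ : ∀ x, μ {x} = 0) :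
    Measure.map (fun x => (μ (Iic x)).toReal) μ = volume.restrict (Ioc 0 (μ univ).toReal) := by
  set F : ℝ → ℝ := fun x => (μ (Iic x)).toReal with hF
  have hmono : Monotone F := fun a b hab =>
    ENNReal.toReal_mono (measure_ne_top _ _) (measure_mono (Iic_subset_Iic.2 hab))
  have hbot : Filter.Tendsto F Filter.atBot (nhds 0) := by
    have := tendsto_measure_iInter_atBot (μ := μ) (s := fun x : ℝ => Iic x)
      (fun x => measurableSet_Iic.nullMeasurableSet) (fun a b h => Iic_subset_Iic.2 h)
      ⟨0, measure_ne_top _ _⟩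
    rw [iInter_Iic_eq_empty_iff.2 (by simp [not_bddBelow_univ]), measure_empty] at this
    exact (ENNReal.tendsto_toReal zero_ne_top).comp this
  have htop : Filter.Tendsto F Filter.atTop (nhds (μ univ).toReal) := by
    exact (ENNReal.tendsto_toReal (measure_ne_top _ _)).comp (tendsto_measure_Iic_atTop μ)
  have hcont : Continuous F := by
    have : NullSingletonClass μ := ⟨hμ⟩
    have h := (intervalIntegral.continuous_primitive (μ := μ) (f := fun _ : ℝ => (1 : ℝ))
      (fun a b => intervalIntegrable_const) 0).add_const (F 0)
    refine h.congr fun b => ?_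
    rw [← intervalIntegral.integral_Iic_sub_Iic (integrable_const _).integrableOn
      (integrable_const _).integrableOn]
    simp [hF, Measure.real]
  have hM : ∀ x, F x ≤ (μ univ).toReal := fun x =>
    ENNReal.toReal_mono (measure_ne_top _ _) (measure_mono (subset_univ _))
  have h0 : ∀ x, 0 ≤ F x := fun x => ENNReal.toReal_nonneg
  have ivt : ∀ a, 0 < a → a < (μ univ).toReal → ∃ x, F x = a := by
    intro a ha haM
    obtain ⟨x, hx⟩ := (hbot.eventually (gt_mem_nhds ha)).exists
    obtain ⟨y, hy⟩ := (htop.eventually (lt_mem_nhds haM)).exists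
    exact mem_range_of_exists_le_of_exists_ge hcont ⟨x, hx.le⟩ ⟨y, hy.le⟩
  refine Measure.ext_of_Iic _ _ fun a => ?_
  rw [Measure.map_apply hmono.measurable measurableSet_Iic,
    Measure.restrict_apply measurableSet_Iic]
  rcases lt_or_ge a 0 with ha | ha
  · have h1 : F ⁻¹' Iic a = ∅ := by
      ext x; simp only [mem_preimage, mem_Iic, mem_empty_iff_false, iff_false, not_le]
      exact ha.trans_le (h0 x)
    have h2 : Iic a ∩ Ioc 0 (μ univ).toReal = ∅ := by
      ext x; simp only [mem_inter_iff, mem_Iic, mem_Ioc, mem_empty_iff_false, iff_false]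
      rintro ⟨h, h', -⟩; linarith
    rw [h1, h2]; simp
  rcases le_or_gt (μ univ).toReal a with haM | haM
  · have h1 : F ⁻¹' Iic a = univ := by
      ext x; simp only [mem_preimage, mem_Iic, mem_univ, iff_true]
      exact (hM x).trans haM
    have h2 : Iic a ∩ Ioc 0 (μ univ).toReal = Ioc 0 (μ univ).toReal := by
      apply inter_eq_right.2
      intro x hx; exact hx.2.trans haM
    rw [h1, h2]; simp
  · have h2 : Iic a ∩ Ioc 0 (μ univ).toReal = Ioc 0 a := by
      ext x; simp only [mem_inter_iff, mem_Iic, mem_Ioc]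
      constructor
      · rintro ⟨h, h', -⟩; exact ⟨h', h⟩
      · rintro ⟨h, h'⟩; exact ⟨h', h, h'.trans haM.le⟩
    rw [h2, Real.volume_Ioc, sub_zero]
    apply le_antisymm
    · apply le_of_forall_gt_imp_ge_of_dense
      intro b hb
      by_cases hbt : b = ∞
      · rw [hbt]; exact le_top
      have hb' : a < b.toReal := (ENNReal.ofReal_lt_iff_lt_toReal ha hbt).1 hb
      obtain ⟨c, hc1, hc2⟩ := exists_between (lt_min hb' haM)
      obtain ⟨x, hx⟩ := ivt c (ha.trans_lt hc1) (hc2.trans_le (min_le_right _ _))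
      have : F ⁻¹' Iic a ⊆ Iic x := by
        intro y hy
        by_contra hxy
        have := hmono (not_le.1 hxy).le
        simp only [mem_preimage, mem_Iic] at hy
        linarith
      calc μ (F ⁻¹' Iic a) ≤ μ (Iic x) := measure_mono this
        _ = ENNReal.ofReal (F x) := (ENNReal.ofReal_toReal (measure_ne_top _ _)).symm
        _ ≤ b := by
          rw [hx]
          exact ENNReal.ofReal_le_of_le_toReal (hc2.le.trans (min_le_left _ _))
    · rcases ha.eq_or_lt with rfl | ha
      · simp
      obtain ⟨x, hx⟩ := ivt a ha haM
      calc ENNReal.ofReal a = μ (Iic x) := by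
            rw [← hx]; exact ENNReal.ofReal_toReal (measure_ne_top _ _)
        _ ≤ _ := measure_mono fun y hy => by
          simp only [mem_preimage, mem_Iic, ← hx]; exact hmono hy

lemma lintegral_comp_measure_Iic (μ : Measure ℝ) [IsFiniteMeasure μ] (hμ : ∀ x, μ {x} = 0)
    {φ : ℝ≥0∞ → ℝ≥0∞} (hφ : Measurable φ) :
    ∫⁻ x, φ (μ (Iic x)) ∂μ = ∫⁻ z in Ioc 0 (μ univ).toReal, φ (ENNReal.ofReal z) := by
  rw [← map_measure_Iic μ hμ, lintegral_map (by fun_prop)]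
  · simp only [ENNReal.ofReal_toReal (measure_ne_top _ _)]
  · exact (show Monotone (fun x => (μ (Iic x)).toReal) from fun a b hab =>
      ENNReal.toReal_mono (measure_ne_top _ _) (measure_mono (Iic_subset_Iic.2 hab))).measurable

lemma lintegral_comp_measure_Ici (μ : Measure ℝ) [IsFiniteMeasure μ] (hμ : ∀ x, μ {x} = 0)
    {φ : ℝ≥0∞ → ℝ≥0∞} (hφ : Measurable φ) :
    ∫⁻ x, φ (μ (Ici x)) ∂μ = ∫⁻ z in Ioc 0 (μ univ).toReal, φ (ENNReal.ofReal z) := by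
  have hm : Monotone fun y : ℝ => μ.map Neg.neg (Iic y) := fun a b hab =>
    measure_mono (Iic_subset_Iic.2 hab)
  have := lintegral_comp_measure_Iic (μ.map Neg.neg) (fun x => by
    rw [Measure.map_apply measurable_neg (measurableSet_singleton x)]
    simpa using hμ (-x)) hφ
  rw [lintegral_map (f := fun y => φ (μ.map Neg.neg (Iic y))) (hφ.comp hm.measurable)
    measurable_neg, Measure.map_apply measurable_neg MeasurableSet.univ, preimage_univ] at this
  rw [← this]
  refine lintegral_congr fun x => ?_
  rw [Measure.map_apply measurable_neg measurableSet_Iic]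
  simp

lemma lintegral_Ioc_comp_lintegral_Ioc {f : ℝ → ℝ≥0∞} (hf : Measurable f) {a b : ℝ}
    (hfin : ∫⁻ t in Ioc a b, f t ≠ ∞) {φ : ℝ≥0∞ → ℝ≥0∞} (hφ : Measurable φ) :
    ∫⁻ t in Ioc a b, φ (∫⁻ s in Ioc a t, f s) * f t =
      ∫⁻ z in Ioc 0 (∫⁻ t in Ioc a b, f t).toReal, φ (ENNReal.ofReal z) := by
  set μ := (volume.restrict (Ioc a b)).withDensity f with hμ
  have : IsFiniteMeasure μ := isFiniteMeasure_withDensity hfin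
  have hm : Monotone fun t : ℝ => ∫⁻ s in Ioc a t, f s := fun x y hxy =>
    lintegral_mono_set (Ioc_subset_Ioc_right hxy)
  have h := lintegral_comp_measure_Iic μ (fun x => by
    rw [hμ, withDensity_apply _ (measurableSet_singleton x)]
    refine setLIntegral_measure_zero _ _ ?_
    exact Measure.absolutelyContinuous_of_le Measure.restrict_le_self (by simp)) hφ
  have hu : μ univ = ∫⁻ t in Ioc a b, f t := by simp [hμ]
  rw [hu] at h
  rw [← h]
  rw [hμ, lintegral_withDensity_eq_lintegral_mul _ hf]
  · refine setLIntegral_congr_fun measurableSet_Ioc fun t ht => ?_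
    simp only [Pi.mul_apply]
    rw [withDensity_apply _ measurableSet_Iic, Measure.restrict_restrict measurableSet_Iic,
      mul_comm]
    congr 4
    ext s; simp only [mem_Ioc, mem_inter_iff, mem_Iic]
    constructor
    · rintro ⟨h1, h2⟩; exact ⟨h2, h1, h2.trans ht.2⟩
    · rintro ⟨h1, h2, -⟩; exact ⟨h2, h1⟩
  · exact hφ.comp (show Monotone fun x => μ (Iic x) from fun a b hab =>
      measure_mono (Iic_subset_Iic.2 hab)).measurable

lemma lintegral_Ioi_comp_lintegral_Ioi {f : ℝ → ℝ≥0∞} (hf : Measurable f) {a : ℝ}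
    (hfin : ∫⁻ t in Ioi a, f t ≠ ∞) {φ : ℝ≥0∞ → ℝ≥0∞} (hφ : Measurable φ) :
    ∫⁻ t in Ioi a, φ (∫⁻ s in Ioi t, f s) * f t =
      ∫⁻ z in Ioc 0 (∫⁻ t in Ioi a, f t).toReal, φ (ENNReal.ofReal z) := by
  set μ := (volume.restrict (Ioi a)).withDensity f with hμ
  have : IsFiniteMeasure μ := isFiniteMeasure_withDensity hfin
  have h := lintegral_comp_measure_Ici μ (fun x => by
    rw [hμ, withDensity_apply _ (measurableSet_singleton x)]
    refine setLIntegral_measure_zero _ _ ?_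
    exact Measure.absolutelyContinuous_of_le Measure.restrict_le_self (by simp)) hφ
  have hu : μ univ = ∫⁻ t in Ioi a, f t := by simp [hμ]
  rw [hu] at h
  rw [← h]
  rw [hμ, lintegral_withDensity_eq_lintegral_mul _ hf]
  · refine setLIntegral_congr_fun measurableSet_Ioi fun t ht => ?_
    simp only [Pi.mul_apply]
    rw [withDensity_apply _ measurableSet_Ici, Measure.restrict_restrict measurableSet_Ici,
      mul_comm, inter_eq_left.2 (Ici_subset_Ioi.2 ht),
      setLIntegral_congr Ioi_ae_eq_Ici]
  · exact hφ.comp (show Antitone fun x => μ (Ici x) from fun a b hab =>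
      measure_mono (Ici_subset_Ici.2 hab)).measurable

lemma lintegral_Ioc_ofReal_rpow {e : ℝ} (he : 0 < e) {M : ℝ≥0∞} (hM : M ≠ ∞) :
    ∫⁻ z in Ioc 0 M.toReal, ENNReal.ofReal z ^ (e - 1) = ENNReal.ofReal (1 / e) * M ^ e := by
  have hM0 : 0 ≤ M.toReal := ENNReal.toReal_nonneg
  have hpow : IntervalIntegrable (fun z : ℝ => z ^ (e - 1)) volume 0 M.toReal :=
    intervalIntegral.intervalIntegrable_rpow' (by linarith)
  have h1 : ∫⁻ z in Ioc 0 M.toReal, ENNReal.ofReal z ^ (e - 1) =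
      ∫⁻ z in Ioc 0 M.toReal, ENNReal.ofReal (z ^ (e - 1)) :=
    setLIntegral_congr_fun measurableSet_Ioc fun z hz => ENNReal.ofReal_rpow_of_pos hz.1
  rw [h1, ← ofReal_integral_eq_lintegral_ofReal]
  · rw [← intervalIntegral.integral_of_le hM0, integral_rpow (Or.inl (by linarith)),
      sub_add_cancel, Real.zero_rpow he.ne', sub_zero, div_eq_inv_mul, ENNReal.ofReal_mul
      (by positivity), ← ENNReal.ofReal_rpow_of_nonneg hM0 he.le, ENNReal.ofReal_toReal hM, one_div]
  · exact (intervalIntegrable_iff_integrableOn_Ioc_of_le hM0).1 hpow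
  · filter_upwards [ae_restrict_mem measurableSet_Ioc] with z hz
    exact Real.rpow_nonneg hz.1.le _

lemma lintegral_Ioc_add_ofReal_rpow_neg_le {e : ℝ} (he : 0 < e) {c : ℝ≥0∞} (hc : c ≠ ∞)
    (hc0 : c ≠ 0) {M : ℝ} (hM0 : 0 ≤ M) :
    ∫⁻ z in Ioc 0 M, (c + ENNReal.ofReal z) ^ (-e - 1) ≤ ENNReal.ofReal (1 / e) * c ^ (-e) := by
  lift c to ℝ≥0 using hc
  have hc0 : 0 < (c : ℝ) := by
    have : c ≠ 0 := by simpa using hc0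
    positivity
  have hpow : IntervalIntegrable (fun z : ℝ => z ^ (-e - 1)) volume c (c + M) :=
    intervalIntegral.intervalIntegrable_rpow (Or.inr (by
      rw [uIcc_of_le (by linarith)]; intro h; linarith [h.1]))
  have h1 : ∫⁻ z in Ioc 0 M, ((c : ℝ≥0∞) + ENNReal.ofReal z) ^ (-e - 1) =
      ∫⁻ z in Ioc 0 M, ENNReal.ofReal ((c + z) ^ (-e - 1)) :=
    setLIntegral_congr_fun measurableSet_Ioc fun z hz => by
      have := hz.1
      rw [← ENNReal.ofReal_coe_nnreal, ← ENNReal.ofReal_add hc0.le hz.1.le,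
        ENNReal.ofReal_rpow_of_pos (by linarith)]
  have hpow' : IntervalIntegrable (fun z : ℝ => (c + z) ^ (-e - 1)) volume 0 M := by
    have := hpow.comp_add_left c
    simpa using this
  rw [h1, ← ofReal_integral_eq_lintegral_ofReal]
  · rw [← intervalIntegral.integral_of_le hM0,
      intervalIntegral.integral_comp_add_left (fun z : ℝ => z ^ (-e - 1)), add_zero, integral_rpow
      (Or.inr ⟨by linarith, by rw [uIcc_of_le (by linarith)]; intro h; linarith [h.1]⟩),
      sub_add_cancel, ← ENNReal.ofReal_coe_nnreal, ENNReal.ofReal_rpow_of_pos hc0,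
      ← ENNReal.ofReal_mul (by positivity)]
    apply ENNReal.ofReal_le_ofReal
    have : 0 ≤ ((c : ℝ) + M) ^ (-e) := by positivity
    rw [div_neg, ← neg_div, neg_sub, one_div, div_eq_inv_mul]
    gcongr
    linarith
  · exact (intervalIntegrable_iff_integrableOn_Ioc_of_le hM0).1 hpow'
  · filter_upwards [ae_restrict_mem measurableSet_Ioc] with z hz
    have := hz.1
    exact Real.rpow_nonneg (by linarith) _

lemma lintegral_Ioc_rpow_lintegral {f : ℝ → ℝ≥0∞} (hf : Measurable f) {a b : ℝ}
    (hfin : ∫⁻ t in Ioc a b, f t ≠ ∞) {e : ℝ} (he : 0 < e) :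
    ∫⁻ t in Ioc a b, (∫⁻ s in Ioc a t, f s) ^ (e - 1) * f t =
      ENNReal.ofReal (1 / e) * (∫⁻ t in Ioc a b, f t) ^ e := by
  rw [← lintegral_Ioc_ofReal_rpow he hfin]
  exact lintegral_Ioc_comp_lintegral_Ioc hf hfin (φ := fun z => z ^ (e - 1)) (by fun_prop)

lemma lintegral_Ioi_rpow_lintegral {f : ℝ → ℝ≥0∞} (hf : Measurable f) {a : ℝ}
    (hfin : ∫⁻ t in Ioi a, f t ≠ ∞) {e : ℝ} (he : 0 < e) :
    ∫⁻ t in Ioi a, (∫⁻ s in Ioi t, f s) ^ (e - 1) * f t =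
      ENNReal.ofReal (1 / e) * (∫⁻ t in Ioi a, f t) ^ e := by
  rw [← lintegral_Ioc_ofReal_rpow he hfin]
  exact lintegral_Ioi_comp_lintegral_Ioi hf hfin (φ := fun z => z ^ (e - 1)) (by fun_prop)

lemma lintegral_Ioc_add {f : ℝ → ℝ≥0∞} {a b c : ℝ} (hab : a ≤ b) (hbc : b ≤ c) :
    ∫⁻ t in Ioc a c, f t = (∫⁻ t in Ioc a b, f t) + ∫⁻ t in Ioc b c, f t := by
  rw [← Ioc_union_Ioc_eq_Ioc hab hbc, lintegral_union measurableSet_Ioc]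
  exact Ioc_disjoint_Ioc_of_le le_rfl

lemma lintegral_Ioi_le_of_forall_Ioc {f : ℝ → ℝ≥0∞} {a : ℝ} {c : ℝ≥0∞}
    (h : ∀ b, a ≤ b → ∫⁻ t in Ioc a b, f t ≤ c) : ∫⁻ t in Ioi a, f t ≤ c := by
  have hU : ⋃ n : ℕ, Ioc a (a + n) = Ioi a := by
    ext x
    simp only [mem_iUnion, mem_Ioc, mem_Ioi]
    refine ⟨fun ⟨n, h, _⟩ => h, fun h => ?_⟩
    obtain ⟨n, hn⟩ := exists_nat_ge (x - a)
    exact ⟨n, h, by linarith⟩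
  rw [← hU, setLIntegral_iUnion_of_directed]
  · exact iSup_le fun n => h _ (by simp)
  · refine Monotone.directed_le fun m n hmn => Ioc_subset_Ioc_right ?_
    gcongr

lemma lintegral_Ioi_rpow_neg_lintegral_le {f : ℝ → ℝ≥0∞} (hf : Measurable f) {a b : ℝ}
    (hab : a ≤ b) (hfin : ∀ c, ∫⁻ t in Ioc a c, f t ≠ ∞) (h0 : ∫⁻ t in Ioc a b, f t ≠ 0)
    {e : ℝ} (he : 0 < e) :
    ∫⁻ t in Ioi b, (∫⁻ s in Ioc a t, f s) ^ (-e - 1) * f t ≤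
      ENNReal.ofReal (1 / e) * (∫⁻ t in Ioc a b, f t) ^ (-e) := by
  refine lintegral_Ioi_le_of_forall_Ioc fun c hc => ?_
  have h1 : ∫⁻ t in Ioc b c, f t ≠ ∞ :=
    ne_top_of_le_ne_top (hfin c) (lintegral_mono_set (Ioc_subset_Ioc_left hab))
  refine le_trans (le_of_eq ?_) (lintegral_Ioc_add_ofReal_rpow_neg_le he (hfin b) h0
    (ENNReal.toReal_nonneg (a := ∫⁻ t in Ioc b c, f t)))
  rw [← lintegral_Ioc_comp_lintegral_Ioc hf h1
    (φ := fun z => ((∫⁻ t in Ioc a b, f t) + z) ^ (-e - 1)) (by fun_prop)]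
  refine setLIntegral_congr_fun measurableSet_Ioc fun t ht => ?_
  simp only [lintegral_Ioc_add hab ht.1.le]

/-- Tonelli's theorem on the triangle `{(s, t) | a < s ≤ t}`. -/
lemma lintegral_Ioi_lintegral_Ioc_swap {f : ℝ → ℝ → ℝ≥0∞} (hf : Measurable (Function.uncurry f))
    (a : ℝ) :
    ∫⁻ t in Ioi a, ∫⁻ s in Ioc a t, f s t = ∫⁻ s in Ioi a, ∫⁻ t in Ioi s, f s t := by
  have hm : Measurable (Function.uncurry fun t s : ℝ => (Iic t).indicator (fun s => f s t) s) := by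
    have hs : MeasurableSet {z : ℝ × ℝ | z.2 ≤ z.1} := measurableSet_le measurable_snd measurable_fst
    have := (hf.comp measurable_swap).indicator hs
    convert this using 1
    ext ⟨t, s⟩; simp [indicator, Function.uncurry]
  calc ∫⁻ t in Ioi a, ∫⁻ s in Ioc a t, f s t
      = ∫⁻ t in Ioi a, ∫⁻ s in Ioi a, (Iic t).indicator (fun s => f s t) s := by
        refine lintegral_congr fun t => ?_
        rw [setLIntegral_indicator measurableSet_Iic]
        congr 2
        ext s; simp [and_comm]
    _ = ∫⁻ s in Ioi a, ∫⁻ t in Ioi a, (Iic t).indicator (fun s => f s t) s :=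
        lintegral_lintegral_swap hm.aemeasurable
    _ = ∫⁻ s in Ioi a, ∫⁻ t in Ioi s, f s t := by
        refine setLIntegral_congr_fun measurableSet_Ioi fun s hs => ?_
        have : ∀ t, (Iic t).indicator (fun s => f s t) s = (Ici s).indicator (fun t => f s t) t := by
          intro t; simp [indicator]
        simp only [this]
        rw [setLIntegral_indicator measurableSet_Ici, inter_eq_left.2 (Ici_subset_Ioi.2 hs),
          setLIntegral_congr Ioi_ae_eq_Ici]

lemma lintegral_Ioi_lintegral_Ioc_mul {f g : ℝ → ℝ≥0∞} (hf : Measurable f) (hg : Measurable g)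
    (a : ℝ) :
    ∫⁻ t in Ioi a, (∫⁻ s in Ioc a t, f s) * g t = ∫⁻ s in Ioi a, f s * ∫⁻ t in Ioi s, g t := by
  have := lintegral_Ioi_lintegral_Ioc_swap (f := fun s t => f s * g t) (by fun_prop) a
  simp only [lintegral_const_mul _ hg, lintegral_mul_const _ hf] at this
  exact this

lemma ENNReal.le_rpow_of_le_mul_rpow {x M : ℝ≥0∞} {θ : ℝ} (hθ : 0 < θ) (hx : x ≠ ∞)
    (h : x ≤ M * x ^ (1 - 1 / θ)) : x ≤ M ^ θ := by
  rcases eq_or_ne x 0 with rfl | h0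
  · exact zero_le
  have h1 : x ^ (1 / θ) ≤ M := by
    have h2 : x = x ^ (1 / θ) * x ^ (1 - 1 / θ) := by
      rw [← ENNReal.rpow_add _ _ h0 hx, add_sub_cancel, ENNReal.rpow_one]
    have h3 : x ^ (1 - 1 / θ) ≠ 0 := by simp [ENNReal.rpow_eq_zero_iff, h0, hx]
    have h4 : x ^ (1 - 1 / θ) ≠ ∞ := by simp [ENNReal.rpow_eq_top_iff, h0, hx]
    rw [← ENNReal.mul_le_mul_iff_left h3 h4]
    exact h2.symm.le.trans h
  calc x = (x ^ (1 / θ)) ^ θ := by rw [← ENNReal.rpow_mul, one_div_mul_cancel hθ.ne',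
        ENNReal.rpow_one]
    _ ≤ _ := ENNReal.rpow_le_rpow h1 hθ.le

/-- Minkowski's integral inequality. -/
lemma lintegral_rpow_lintegral_le {α β : Type*} [MeasurableSpace α] [MeasurableSpace β]
    (μ : Measure α) (ν : Measure β) [SFinite μ] [SigmaFinite ν] {k : α → β → ℝ≥0∞}
    (hk : Measurable (Function.uncurry k)) {θ : ℝ} (hθ : 1 ≤ θ) :
    ∫⁻ t, (∫⁻ s, k s t ∂μ) ^ θ ∂ν ≤ (∫⁻ s, (∫⁻ t, k s t ^ θ ∂ν) ^ (1 / θ) ∂μ) ^ θ := by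
  have hθ0 : 0 < θ := by linarith
  set F : β → ℝ≥0∞ := fun t => ∫⁻ s, k s t ∂μ with hF
  have hFm : Measurable F := Measurable.lintegral_prod_left' hk
  set Fn : ℕ → β → ℝ≥0∞ := fun n => (spanningSets ν n).indicator fun t => min (F t) n with hFn
  have hFnm : ∀ n, Measurable (Fn n) := fun n =>
    (hFm.min measurable_const).indicator (measurableSet_spanningSets ν n)
  have hle : ∀ n t, Fn n t ≤ F t := fun n t =>
    indicator_le_self' (fun _ _ => zero_le) t |>.trans (min_le_left _ _)
  have hbound : ∀ n, ∫⁻ t, Fn n t ^ θ ∂ν ≤ (∫⁻ s, (∫⁻ t, k s t ^ θ ∂ν) ^ (1 / θ) ∂μ) ^ θ := by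
    intro n
    apply ENNReal.le_rpow_of_le_mul_rpow hθ0
    · have : ∫⁻ t, Fn n t ^ θ ∂ν ≤ ∫⁻ t, (spanningSets ν n).indicator (fun _ => (n : ℝ≥0∞) ^ θ) t ∂ν := by
        refine lintegral_mono fun t => ?_
        by_cases ht : t ∈ spanningSets ν n
        · simp only [hFn, indicator_of_mem ht]
          exact ENNReal.rpow_le_rpow (min_le_right _ _) hθ0.le
        · simp [hFn, indicator_of_notMem ht, hθ0]
      refine ne_top_of_le_ne_top ?_ this
      rw [lintegral_indicator_const (measurableSet_spanningSets ν n)]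
      exact ENNReal.mul_ne_top (by simp [hθ0.le]) (measure_spanningSets_lt_top ν n).ne
    · calc ∫⁻ t, Fn n t ^ θ ∂ν ≤ ∫⁻ t, F t * Fn n t ^ (θ - 1) ∂ν := by
            refine lintegral_mono fun t => ?_
            have : Fn n t ^ θ = Fn n t * Fn n t ^ (θ - 1) := by
              conv_rhs => rw [← ENNReal.rpow_one (Fn n t), ← ENNReal.rpow_mul, one_mul,
                ← ENNReal.rpow_add_of_nonneg _ _ zero_le_one (by linarith)]
              congr 1; ring
            rw [this]
            gcongr
            exact hle n t
        _ = ∫⁻ t, ∫⁻ s, k s t * Fn n t ^ (θ - 1) ∂μ ∂ν := by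
            refine lintegral_congr fun t => ?_
            rw [lintegral_mul_const]
            exact hk.comp measurable_prodMk_right
        _ = ∫⁻ s, ∫⁻ t, k s t * Fn n t ^ (θ - 1) ∂ν ∂μ := by
            refine lintegral_lintegral_swap (f := fun t s => k s t * Fn n t ^ (θ - 1)) ?_
            have h1 : Measurable fun z : β × α => k z.2 z.1 := hk.comp measurable_swap
            exact (h1.mul (((hFnm n).comp measurable_fst).pow_const _)).aemeasurable
        _ ≤ ∫⁻ s, (∫⁻ t, k s t ^ θ ∂ν) ^ (1 / θ) * (∫⁻ t, Fn n t ^ θ ∂ν) ^ (1 - 1 / θ) ∂μ := by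
            refine lintegral_mono fun s => ?_
            have h1 : Measurable (k s) := hk.comp measurable_prodMk_left
            have := ENNReal.lintegral_mul_norm_pow_le (μ := ν) (h1.pow_const θ).aemeasurable
              ((hFnm n).pow_const θ).aemeasurable (p := 1 / θ) (q := 1 - 1 / θ) (by positivity)
              (by rw [sub_nonneg, div_le_one hθ0]; exact hθ) (by ring)
            refine le_trans (le_of_eq ?_) this
            refine lintegral_congr fun t => ?_
            rw [← ENNReal.rpow_mul, ← ENNReal.rpow_mul, mul_one_div_cancel hθ0.ne',
              ENNReal.rpow_one]
            congr 2; field_simp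
        _ = _ := by
            rw [lintegral_mul_const]
            exact ((hk.pow_const θ).lintegral_prod_right').pow_const _
  calc ∫⁻ t, F t ^ θ ∂ν = ∫⁻ t, Filter.liminf (fun n => Fn n t ^ θ) Filter.atTop ∂ν := by
        refine lintegral_congr fun t => ?_
        refine (Filter.Tendsto.liminf_eq ?_).symm
        refine (ENNReal.continuous_rpow_const.tendsto _).comp ?_
        have h1 : Filter.Tendsto (fun n : ℕ => min (F t) (n : ℝ≥0∞)) Filter.atTop (nhds (F t)) := by
          have := (tendsto_const_nhds (x := F t)).min ENNReal.tendsto_nat_nhds_top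
          simpa using this
        refine h1.congr' ?_
        filter_upwards [Filter.eventually_ge_atTop (spanningSetsIndex ν t)] with n hn
        exact (indicator_of_mem (monotone_spanningSets ν hn (mem_spanningSetsIndex ν t))
          fun t => min (F t) (n : ℝ≥0∞)).symm
    _ ≤ Filter.liminf (fun n => ∫⁻ t, Fn n t ^ θ ∂ν) Filter.atTop :=
        lintegral_liminf_le fun n => (hFnm n).pow_const _
    _ ≤ _ := Filter.liminf_le_of_le (by isBoundedDefault) fun b hb => by
        obtain ⟨n, hn⟩ := hb.exists
        exact hn.trans (hbound n)

lemma lintegral_rpow_lintegral_Ioc_le {f g : ℝ → ℝ≥0∞} (hf : Measurable f) (hg : Measurable g)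
    {a θ : ℝ} (hθ : 1 ≤ θ) :
    ∫⁻ t in Ioi a, (∫⁻ s in Ioc a t, f s) ^ θ * g t ≤
      (∫⁻ s in Ioi a, f s * (∫⁻ t in Ioi s, g t) ^ (1 / θ)) ^ θ := by
  have hθ0 : 0 < θ := by linarith
  have hs : MeasurableSet {z : ℝ × ℝ | z.1 ≤ z.2} := measurableSet_le measurable_fst measurable_snd
  have hm : Measurable (Function.uncurry fun s t : ℝ =>
      (Iic t).indicator f s * g t ^ (1 / θ)) := by
    have h1 := (hf.comp measurable_fst).indicator hs
    exact Measurable.mul (by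
      convert h1 using 1
      ext ⟨s, t⟩; simp [indicator]) ((hg.comp measurable_snd).pow_const _)
  have h := lintegral_rpow_lintegral_le (volume.restrict (Ioi a)) (volume.restrict (Ioi a)) hm hθ
  refine le_trans (le_of_eq ?_) (h.trans (le_of_eq ?_))
  · refine lintegral_congr fun t => ?_
    rw [lintegral_mul_const _ (hf.indicator measurableSet_Iic),
      setLIntegral_indicator measurableSet_Iic, ENNReal.mul_rpow_of_nonneg _ _ hθ0.le,
      ← ENNReal.rpow_mul, one_div_mul_cancel hθ0.ne', ENNReal.rpow_one]
    congr 4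
    ext s; simp [and_comm]
  · congr 1
    refine setLIntegral_congr_fun measurableSet_Ioi fun s hs => ?_
    have : ∀ t, ((Iic t).indicator f s * g t ^ (1 / θ)) ^ θ =
        (Ici s).indicator (fun t => f s ^ θ * g t) t := by
      intro t
      by_cases hst : s ≤ t
      · simp only [indicator, mem_Iic, mem_Ici, hst, if_true]
        rw [ENNReal.mul_rpow_of_nonneg _ _ hθ0.le, ← ENNReal.rpow_mul,
          one_div_mul_cancel hθ0.ne', ENNReal.rpow_one]
      · simp [indicator, hst, hθ0]
    simp only [this]
    rw [setLIntegral_indicator measurableSet_Ici, inter_eq_left.2 (Ici_subset_Ioi.2 hs),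
      lintegral_const_mul _ hg, ENNReal.mul_rpow_of_nonneg _ _ (by positivity),
      ← ENNReal.rpow_mul, mul_one_div_cancel hθ0.ne', ENNReal.rpow_one,
      setLIntegral_congr Ioi_ae_eq_Ici]

lemma lintegral_rpow_lintegral_Ioi_le {f g : ℝ → ℝ≥0∞} (hf : Measurable f) (hg : Measurable g)
    {a θ : ℝ} (hθ : 1 ≤ θ) :
    ∫⁻ t in Ioi a, (∫⁻ s in Ioi t, f s) ^ θ * g t ≤
      (∫⁻ s in Ioi a, f s * (∫⁻ t in Ioc a s, g t) ^ (1 / θ)) ^ θ := by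
  have hθ0 : 0 < θ := by linarith
  have hs : MeasurableSet {z : ℝ × ℝ | z.2 ≤ z.1} := measurableSet_le measurable_snd measurable_fst
  have hm : Measurable (Function.uncurry fun s t : ℝ =>
      (Ici t).indicator f s * g t ^ (1 / θ)) := by
    have h1 := (hf.comp measurable_fst).indicator hs
    exact Measurable.mul (by
      convert h1 using 1
      ext ⟨s, t⟩; simp [indicator]) ((hg.comp measurable_snd).pow_const _)
  have h := lintegral_rpow_lintegral_le (volume.restrict (Ioi a)) (volume.restrict (Ioi a)) hm hθ
  refine le_trans (le_of_eq ?_) (h.trans (le_of_eq ?_))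
  · refine setLIntegral_congr_fun measurableSet_Ioi fun t ht => ?_
    rw [lintegral_mul_const _ (hf.indicator measurableSet_Ici),
      setLIntegral_indicator measurableSet_Ici, ENNReal.mul_rpow_of_nonneg _ _ hθ0.le,
      ← ENNReal.rpow_mul, one_div_mul_cancel hθ0.ne', ENNReal.rpow_one,
      inter_eq_left.2 (Ici_subset_Ioi.2 ht), setLIntegral_congr Ioi_ae_eq_Ici]
  · congr 1
    refine lintegral_congr fun s => ?_
    have : ∀ t, ((Ici t).indicator f s * g t ^ (1 / θ)) ^ θ =
        (Iic s).indicator (fun t => f s ^ θ * g t) t := by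
      intro t
      by_cases hst : t ≤ s
      · simp only [indicator, mem_Iic, mem_Ici, hst, if_true]
        rw [ENNReal.mul_rpow_of_nonneg _ _ hθ0.le, ← ENNReal.rpow_mul,
          one_div_mul_cancel hθ0.ne', ENNReal.rpow_one]
      · simp [indicator, hst, hθ0]
    simp only [this]
    rw [setLIntegral_indicator measurableSet_Iic, lintegral_const_mul _ hg,
      ENNReal.mul_rpow_of_nonneg _ _ (by positivity),
      ← ENNReal.rpow_mul, mul_one_div_cancel hθ0.ne', ENNReal.rpow_one]
    congr 4
    ext t; simp [and_comm]

/-- The Hardy operator on `(0, ∞)`. -/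
def hardy (f : ℝ → ℝ≥0∞) (t : ℝ) : ℝ≥0∞ := ∫⁻ s in Ioc (0 : ℝ) t, f s

/-- The Copson operator. -/
def copson (f : ℝ → ℝ≥0∞) (t : ℝ) : ℝ≥0∞ := ∫⁻ s in Ioi t, f s

lemma hardy_mono (f : ℝ → ℝ≥0∞) : Monotone (hardy f) := fun _ _ h =>
  lintegral_mono_set (Ioc_subset_Ioc_right h)

lemma copson_anti (f : ℝ → ℝ≥0∞) : Antitone (copson f) := fun _ _ h =>
  lintegral_mono_set (Ioi_subset_Ioi h)

@[fun_prop]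
lemma measurable_hardy (f : ℝ → ℝ≥0∞) : Measurable (hardy f) := (hardy_mono f).measurable

@[fun_prop]
lemma measurable_copson (f : ℝ → ℝ≥0∞) : Measurable (copson f) := (copson_anti f).measurable

lemma lintegral_hardy_rpow {f : ℝ → ℝ≥0∞} (hf : Measurable f) {b : ℝ} (hfin : hardy f b ≠ ∞)
    {e : ℝ} (he : 0 < e) :
    ∫⁻ t in Ioc 0 b, hardy f t ^ (e - 1) * f t = ENNReal.ofReal (1 / e) * hardy f b ^ e :=
  lintegral_Ioc_rpow_lintegral hf hfin he

lemma hardy_rpow_eq {f : ℝ → ℝ≥0∞} (hf : Measurable f) {b : ℝ} (hfin : hardy f b ≠ ∞)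
    {e : ℝ} (he : 0 < e) :
    hardy f b ^ e = ENNReal.ofReal e * ∫⁻ t in Ioc 0 b, hardy f t ^ (e - 1) * f t := by
  rw [lintegral_hardy_rpow hf hfin he, ← mul_assoc, ← ENNReal.ofReal_mul he.le,
    mul_one_div_cancel he.ne', ENNReal.ofReal_one, one_mul]

lemma lintegral_copson_rpow {f : ℝ → ℝ≥0∞} (hf : Measurable f) {a : ℝ} (hfin : copson f a ≠ ∞)
    {e : ℝ} (he : 0 < e) :
    ∫⁻ t in Ioi a, copson f t ^ (e - 1) * f t = ENNReal.ofReal (1 / e) * copson f a ^ e :=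
  lintegral_Ioi_rpow_lintegral hf hfin he

lemma copson_rpow_eq {f : ℝ → ℝ≥0∞} (hf : Measurable f) {b : ℝ} (hfin : copson f b ≠ ∞)
    {e : ℝ} (he : 0 < e) :
    copson f b ^ e = ENNReal.ofReal e * ∫⁻ t in Ioi b, copson f t ^ (e - 1) * f t := by
  rw [lintegral_copson_rpow hf hfin he, ← mul_assoc, ← ENNReal.ofReal_mul he.le,
    mul_one_div_cancel he.ne', ENNReal.ofReal_one, one_mul]

lemma lintegral_hardy_rpow_neg_le {f : ℝ → ℝ≥0∞} (hf : Measurable f) {b : ℝ} (hb : 0 ≤ b)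
    (hfin : ∀ c, hardy f c ≠ ∞) (h0 : hardy f b ≠ 0) {e : ℝ} (he : 0 < e) :
    ∫⁻ t in Ioi b, hardy f t ^ (-e - 1) * f t ≤ ENNReal.ofReal (1 / e) * hardy f b ^ (-e) :=
  lintegral_Ioi_rpow_neg_lintegral_le hf hb hfin h0 he

lemma lintegral_hardy_mul {f g : ℝ → ℝ≥0∞} (hf : Measurable f) (hg : Measurable g) :
    ∫⁻ t in Ioi (0 : ℝ), hardy f t * g t = ∫⁻ s in Ioi (0 : ℝ), f s * copson g s :=
  lintegral_Ioi_lintegral_Ioc_mul hf hg 0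

/-- `v` is an a.e. positive and finite function on `(0, ∞)` whose dual weight `σ = v ^ (1 - p')`
has a positive finite primitive. -/
structure DualPair (p : ℝ) (v σ : ℝ → ℝ≥0∞) : Prop where
  measurable_left : Measurable v
  measurable_right : Measurable σ
  ae_ne : ∀ᵐ x ∂volume.restrict (Ioi (0 : ℝ)), v x ≠ 0 ∧ v x ≠ ∞
  eq_rpow : ∀ x, σ x = v x ^ (1 - p / (p - 1))
  hardy_ne_top : ∀ x, hardy σ x ≠ ∞
  hardy_ne_zero : ∀ x, 0 < x → hardy σ x ≠ 0

section DualPair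

variable {p q r : ℝ} {v σ : ℝ → ℝ≥0∞}

lemma DualPair.hardy_rpow_le (D : DualPair p v σ) (hp : 1 < p) {h : ℝ → ℝ≥0∞} (hh : Measurable h)
    {t : ℝ} :
    hardy h t ^ p ≤ ENNReal.ofReal (p / (p - 1)) ^ (p - 1) *
      (hardy (fun s => h s ^ p * v s * hardy σ s ^ ((p - 1) / p)) t *
        hardy σ t ^ ((p - 1) * ((p - 1) / p))) := by
  have hp0 : 0 < p := by linarith
  have hp1 : 0 < p - 1 := by linarith
  have hα : 0 < (p - 1) / p := by positivity
  have hv := D.measurable_left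
  have hσ := D.measurable_right
  have hH := ENNReal.lintegral_mul_norm_pow_le (μ := volume.restrict (Ioc 0 t))
    (f := fun s => h s ^ p * v s * hardy σ s ^ ((p - 1) / p))
    (g := fun s => hardy σ s ^ ((p - 1) / p - 1) * σ s) (by fun_prop) (by fun_prop)
    (p := 1 / p) (q := (p - 1) / p) (by positivity) hα.le (by field_simp; ring)
  rw [lintegral_hardy_rpow hσ (D.hardy_ne_top t) hα] at hH
  have h1 : hardy h t ≤ ∫⁻ s in Ioc 0 t, (h s ^ p * v s * hardy σ s ^ ((p - 1) / p)) ^ (1 / p) *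
      (hardy σ s ^ ((p - 1) / p - 1) * σ s) ^ ((p - 1) / p) := by
    refine lintegral_mono_ae ?_
    filter_upwards [ae_restrict_mem measurableSet_Ioc,
      ae_restrict_of_ae_restrict_of_subset (Ioc_subset_Ioi_self) D.ae_ne] with s hs hvs
    have hV0 := D.hardy_ne_zero s hs.1
    have hVt := D.hardy_ne_top s
    rw [ENNReal.mul_rpow_of_nonneg _ _ (by positivity),
      ENNReal.mul_rpow_of_nonneg _ _ (by positivity), ENNReal.mul_rpow_of_nonneg _ _ (by positivity),
      D.eq_rpow s, ← ENNReal.rpow_mul, ← ENNReal.rpow_mul, ← ENNReal.rpow_mul, ← ENNReal.rpow_mul]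
    have e1 : p * (1 / p) = 1 := by field_simp
    have e2 : (1 - p / (p - 1)) * ((p - 1) / p) = -(1 / p) := by field_simp; ring
    have e3 : ((p - 1) / p - 1) * ((p - 1) / p) = -((p - 1) / p * (1 / p)) := by field_simp; ring
    rw [e1, e2, e3, ENNReal.rpow_one]
    calc h s = h s * (v s ^ (1 / p) * v s ^ (-(1 / p))) *
          (hardy σ s ^ ((p - 1) / p * (1 / p)) * hardy σ s ^ (-((p - 1) / p * (1 / p)))) := by
          rw [← ENNReal.rpow_add _ _ hvs.1 hvs.2, ← ENNReal.rpow_add _ _ hV0 hVt]; simp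
      _ ≤ _ := le_of_eq (by ring)
  have h2 := ENNReal.rpow_le_rpow (h1.trans hH) hp0.le
  refine h2.trans (le_of_eq ?_)
  rw [ENNReal.mul_rpow_of_nonneg _ _ hp0.le, ← ENNReal.rpow_mul, ← ENNReal.rpow_mul,
    one_div_mul_cancel hp0.ne', ENNReal.rpow_one, div_mul_cancel₀ _ hp0.ne',
    ENNReal.mul_rpow_of_nonneg _ _ hp1.le, ← ENNReal.rpow_mul, one_div_div, mul_comm ((p - 1) / p)]
  simp only [hardy]
  ring

lemma DualPair.hardy_inequality_of_le (D : DualPair p v σ) (hp : 1 < p) (hpq : p ≤ q) :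
    ∃ K : ℝ≥0∞, K ≠ ∞ ∧ ∀ n h : ℝ → ℝ≥0∞, Measurable n → Measurable h → ∀ F : ℝ≥0∞, F ≠ 0 → F ≠ ∞ →
      (∀ x, 0 < x → copson n x ^ (1 / q) * hardy σ x ^ ((p - 1) / p) ≤ F) →
      ∫⁻ t in Ioi (0 : ℝ), hardy h t ^ q * n t ≤
        K * F ^ q * (∫⁻ t in Ioi (0 : ℝ), h t ^ p * v t) ^ (q / p) := by
  have hp0 : 0 < p := by linarith
  have hp1 : 0 < p - 1 := by linarith
  have hq0 : 0 < q := by linarith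
  have hα : 0 < (p - 1) / p := by positivity
  have hθ : 1 ≤ q / p := by rwa [one_le_div hp0]
  have hθ0 : 0 < q / p := by positivity
  have hv := D.measurable_left
  have hσ := D.measurable_right
  set c := ENNReal.ofReal (p / (p - 1)) ^ (p - 1) with hc
  refine ⟨c ^ (q / p) * ENNReal.ofReal p, ?_, ?_⟩
  · exact ENNReal.mul_ne_top (by simp [hc, hp1.le, hθ0.le, ENNReal.rpow_eq_top_iff, not_lt.2])
      ENNReal.ofReal_ne_top
  intro n h hn hh F hF0 hFt hF
  set g : ℝ → ℝ≥0∞ := fun s => h s ^ p * v s * hardy σ s ^ ((p - 1) / p) with hg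
  have hgm : Measurable g := by fun_prop
  have hN : ∀ x, 0 < x → copson n x ≠ ∞ := by
    intro x hx hNx
    have := hF x hx
    rw [hNx, ENNReal.top_rpow_of_pos (by positivity), ENNReal.top_mul] at this
    · exact hFt (top_le_iff.1 this)
    · simp [ENNReal.rpow_eq_zero_iff, D.hardy_ne_zero x hx, D.hardy_ne_top x]
  set γ := (p - 1) * ((p - 1) / p) * (q / p) with hγ
  have hk : ∀ s, 0 < s → (∫⁻ t in Ioi s, hardy σ t ^ γ * n t) ^ (1 / (q / p)) *
      hardy σ s ^ ((p - 1) / p) ≤ ENNReal.ofReal p ^ (p / q) * F ^ p := by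
    intro s hs
    have h1 : ∫⁻ t in Ioi s, hardy σ t ^ γ * n t ≤
        F ^ (q * ((p - 1) / p)) * (ENNReal.ofReal p * copson n s ^ (1 / p)) := by
      have := lintegral_copson_rpow hn (hN s hs) (e := 1 / p) (by positivity)
      rw [one_div_one_div] at this
      rw [← this, ← lintegral_const_mul _ (by fun_prop)]
      refine setLIntegral_mono (by fun_prop) fun t ht => ?_
      have ht0 : 0 < t := hs.trans ht
      rw [← mul_assoc]
      gcongr
      have e1 : (1 / p - 1) = -((p - 1) / p) := by field_simp; ring
      rw [e1]
      rcases eq_or_ne (copson n t) 0 with h0 | h0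
      · rw [h0, ENNReal.zero_rpow_of_neg (by linarith), ENNReal.mul_top]
        · exact le_top
        · simp [ENNReal.rpow_eq_zero_iff, hF0, hFt]
      have h2 := ENNReal.rpow_le_rpow (hF t ht0) (z := q * ((p - 1) / p)) (by positivity)
      rw [ENNReal.mul_rpow_of_nonneg _ _ (by positivity), ← ENNReal.rpow_mul,
        ← ENNReal.rpow_mul] at h2
      have e2 : 1 / q * (q * ((p - 1) / p)) = (p - 1) / p := by field_simp
      have e3 : (p - 1) / p * (q * ((p - 1) / p)) = γ := by rw [hγ]; field_simp
      rw [e2, e3] at h2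
      calc hardy σ t ^ γ = (copson n t ^ ((p - 1) / p) * hardy σ t ^ γ) *
            copson n t ^ (-((p - 1) / p)) := by
            rw [mul_right_comm, ← ENNReal.rpow_add _ _ h0 (hN t ht0)]; simp
        _ ≤ _ := by gcongr
    calc _ ≤ (F ^ (q * ((p - 1) / p)) * (ENNReal.ofReal p * copson n s ^ (1 / p))) ^ (1 / (q / p)) *
          hardy σ s ^ ((p - 1) / p) := by gcongr
      _ = F ^ (p - 1) * ENNReal.ofReal p ^ (p / q) * (copson n s ^ (1 / q) *
          hardy σ s ^ ((p - 1) / p)) := by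
          rw [ENNReal.mul_rpow_of_nonneg _ _ (by positivity),
            ENNReal.mul_rpow_of_nonneg _ _ (by positivity), ← ENNReal.rpow_mul, ← ENNReal.rpow_mul]
          have e1 : q * ((p - 1) / p) * (1 / (q / p)) = p - 1 := by field_simp
          have e2 : 1 / p * (1 / (q / p)) = 1 / q := by field_simp
          rw [e1, e2, one_div_div]; ring
      _ ≤ F ^ (p - 1) * ENNReal.ofReal p ^ (p / q) * F := by gcongr; exact hF s hs
      _ = _ := by
          rw [mul_right_comm]
          nth_rw 2 [← ENNReal.rpow_one F]
          rw [← ENNReal.rpow_add _ _ hF0 hFt, sub_add_cancel, mul_comm]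
  calc ∫⁻ t in Ioi (0 : ℝ), hardy h t ^ q * n t
      ≤ ∫⁻ t in Ioi (0 : ℝ), c ^ (q / p) * (hardy g t ^ (q / p) * (hardy σ t ^ γ * n t)) := by
        refine lintegral_mono fun t => ?_
        have h1 := ENNReal.rpow_le_rpow (D.hardy_rpow_le hp hh (t := t)) hθ0.le
        rw [← ENNReal.rpow_mul, mul_div_cancel₀ _ hp0.ne', ENNReal.mul_rpow_of_nonneg _ _ hθ0.le,
          ENNReal.mul_rpow_of_nonneg _ _ hθ0.le, ← ENNReal.rpow_mul (hardy σ t)] at h1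
        rw [← mul_assoc, ← mul_assoc, mul_assoc (c ^ _)]
        gcongr
    _ = c ^ (q / p) * ∫⁻ t in Ioi (0 : ℝ), hardy g t ^ (q / p) * (hardy σ t ^ γ * n t) :=
        lintegral_const_mul _ (by fun_prop)
    _ ≤ c ^ (q / p) * (∫⁻ s in Ioi (0 : ℝ), g s *
          (∫⁻ t in Ioi s, hardy σ t ^ γ * n t) ^ (1 / (q / p))) ^ (q / p) := by
        gcongr
        exact lintegral_rpow_lintegral_Ioc_le (g := fun t => hardy σ t ^ γ * n t) hgm
          (by fun_prop) hθ
    _ ≤ c ^ (q / p) * (∫⁻ s in Ioi (0 : ℝ), (ENNReal.ofReal p ^ (p / q) * F ^ p) *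
          (h s ^ p * v s)) ^ (q / p) := by
        refine mul_le_mul' le_rfl (ENNReal.rpow_le_rpow ?_ hθ0.le)
        refine setLIntegral_mono (by fun_prop) fun s hs => ?_
        rw [hg, mul_comm (ENNReal.ofReal p ^ (p / q) * F ^ p)]
        simp only
        rw [mul_assoc (h s ^ p * v s), mul_comm (hardy σ s ^ _)]
        exact mul_le_mul' le_rfl (hk s hs)
    _ = _ := by
        rw [lintegral_const_mul _ (by fun_prop), ENNReal.mul_rpow_of_nonneg _ _ hθ0.le,
          ENNReal.mul_rpow_of_nonneg _ _ hθ0.le, ← ENNReal.rpow_mul (ENNReal.ofReal p),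
          ← ENNReal.rpow_mul F]
        have e1 : p / q * (q / p) = 1 := by field_simp
        rw [e1, mul_div_cancel₀ _ hp0.ne', ENNReal.rpow_one]
        ring

lemma lintegral_copson_rpow_mul_hardy_rpow {u σ : ℝ → ℝ≥0∞} (hu : Measurable u)
    (hσ : Measurable σ) (hσfin : ∀ x, hardy σ x ≠ ∞) (hufin : copson u 0 ≠ ∞) {d e : ℝ}
    (hd : 0 < d) (he : 0 < e) :
    ∫⁻ s in Ioi (0 : ℝ), copson u s ^ d * (hardy σ s ^ (e - 1) * σ s) =
      ENNReal.ofReal (d / e) *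
        ∫⁻ t in Ioi (0 : ℝ), copson u t ^ (d - 1) * u t * hardy σ t ^ e := by
  have h1 : ∀ s ∈ Ioi (0 : ℝ), copson u s ^ d * (hardy σ s ^ (e - 1) * σ s) =
      ENNReal.ofReal d * ((hardy σ s ^ (e - 1) * σ s) *
        copson (fun t => copson u t ^ (d - 1) * u t) s) := by
    intro s hs
    rw [copson_rpow_eq hu (ne_top_of_le_ne_top hufin (copson_anti u (le_of_lt hs))) hd]
    simp only [copson]
    ring
  have h2 : ∀ t ∈ Ioi (0 : ℝ), hardy (fun s => hardy σ s ^ (e - 1) * σ s) t *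
      (copson u t ^ (d - 1) * u t) =
      ENNReal.ofReal (1 / e) * (copson u t ^ (d - 1) * u t * hardy σ t ^ e) := by
    intro t _
    rw [hardy, lintegral_hardy_rpow hσ (hσfin t) he]
    ring
  rw [setLIntegral_congr_fun measurableSet_Ioi h1, lintegral_const_mul _ (by fun_prop),
    ← lintegral_hardy_mul (by fun_prop) (by fun_prop), setLIntegral_congr_fun measurableSet_Ioi h2,
    lintegral_const_mul _ (by fun_prop), ← mul_assoc, ← ENNReal.ofReal_mul hd.le, mul_one_div]

lemma DualPair.hardy_inequality_of_lt (D : DualPair p v σ) (hp : 1 < p) (hr : 0 < r)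
    (hrp : r < p) :
    ∃ K : ℝ≥0∞, K ≠ ∞ ∧ ∀ u h : ℝ → ℝ≥0∞, Measurable u → Measurable h → copson u 0 ≠ ∞ →
      ∫⁻ t in Ioi (0 : ℝ), hardy h t ^ r * u t ≤
        K * (∫⁻ t in Ioi (0 : ℝ), copson u t ^ (r / (p - r)) * u t *
            hardy σ t ^ ((p - 1) * r / (p - r))) ^ ((p - r) / p) *
          (∫⁻ t in Ioi (0 : ℝ), h t ^ p * v t) ^ (r / p) := by
  have hp0 : 0 < p := by linarith
  have hp1 : 0 < p - 1 := by linarith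
  have hpr : 0 < p - r := by linarith
  have hα : 0 < (p - 1) / p := by positivity
  have hv := D.measurable_left
  have hσ := D.measurable_right
  set c := ENNReal.ofReal (p / (p - 1)) ^ (p - 1) with hc
  have hct : c ≠ ∞ := by simp [hc, hp1.le, ENNReal.rpow_eq_top_iff, not_lt.2]
  set e := ((p - 1) * ((p - 1) / p) + 1) * (r / p) with he
  have he0 : 0 < e := by positivity
  set a := ENNReal.ofReal p + ENNReal.ofReal (p / (p - 1)) with ha
  set b := ENNReal.ofReal (p / (p - r) / ((p - 1) * r / (p - r))) with hb
  refine ⟨c ^ (r / p) * ENNReal.ofReal e * a ^ (r / p) * b ^ ((p - r) / p), ?_, ?_⟩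
  · have h1 : 0 ≤ r / p := by positivity
    have h2 : 0 ≤ (p - r) / p := by positivity
    refine ENNReal.mul_ne_top (ENNReal.mul_ne_top (ENNReal.mul_ne_top ?_ ENNReal.ofReal_ne_top) ?_)
      ?_
    · exact ENNReal.rpow_ne_top_of_nonneg h1 hct
    · exact ENNReal.rpow_ne_top_of_nonneg h1 (by simp [ha])
    · exact ENNReal.rpow_ne_top_of_nonneg h2 (by simp [hb])
  intro u h hu hh hufin
  set g : ℝ → ℝ≥0∞ := fun s => h s ^ p * v s * hardy σ s ^ ((p - 1) / p) with hg
  have hgm : Measurable g := by fun_prop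
  set L : ℝ → ℝ≥0∞ := fun t => ∫⁻ y in Ioi (0 : ℝ), g y * (max (hardy σ y) (hardy σ t))⁻¹ with hL
  have hLanti : Antitone L := fun s t hst => lintegral_mono fun y => by
    have := hardy_mono σ hst
    gcongr
  have hLm : Measurable L := hLanti.measurable
  have hGL : ∀ t, 0 < t → hardy g t ≤ hardy σ t * L t := by
    intro t ht
    have hV0 := D.hardy_ne_zero t ht
    have hVt := D.hardy_ne_top t
    calc hardy g t = hardy σ t * (hardy g t * (hardy σ t)⁻¹) := by
          rw [mul_left_comm, ENNReal.mul_inv_cancel hV0 hVt, mul_one]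
      _ = hardy σ t * ∫⁻ y in Ioc 0 t, g y * (max (hardy σ y) (hardy σ t))⁻¹ := by
          rw [show hardy g t = ∫⁻ y in Ioc 0 t, g y from rfl, ← lintegral_mul_const _ hgm]
          congr 1
          refine setLIntegral_congr_fun measurableSet_Ioc fun y hy => ?_
          rw [max_eq_right (hardy_mono σ hy.2)]
      _ ≤ _ := by
          gcongr
          exact lintegral_mono_set Ioc_subset_Ioi_self
  have hLint : ∫⁻ t in Ioi (0 : ℝ), L t * (hardy σ t ^ (-((p - 1) / p)) * σ t) ≤
      a * ∫⁻ t in Ioi (0 : ℝ), h t ^ p * v t := by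
    have hinner : ∀ y, 0 < y → ∫⁻ t in Ioi (0 : ℝ), (max (hardy σ y) (hardy σ t))⁻¹ *
        (hardy σ t ^ (-((p - 1) / p)) * σ t) ≤ a * hardy σ y ^ (-((p - 1) / p)) := by
      intro y hy
      have hV0 := D.hardy_ne_zero y hy
      have hVt := D.hardy_ne_top y
      rw [← Ioc_union_Ioi_eq_Ioi hy.le, lintegral_union measurableSet_Ioi
        (Ioc_disjoint_Ioi le_rfl), ha, add_mul]
      refine add_le_add ?_ ?_
      · have h1 : ∀ t ∈ Ioc 0 y, (max (hardy σ y) (hardy σ t))⁻¹ *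
            (hardy σ t ^ (-((p - 1) / p)) * σ t) =
            (hardy σ y)⁻¹ * (hardy σ t ^ (1 / p - 1) * σ t) := by
          intro t ht
          rw [max_eq_left (hardy_mono σ ht.2)]
          congr 3
          field_simp; ring
        rw [setLIntegral_congr_fun measurableSet_Ioc h1, lintegral_const_mul _ (by fun_prop),
          lintegral_hardy_rpow hσ hVt (by positivity), one_div_one_div, ← ENNReal.rpow_neg_one,
          mul_left_comm, ← ENNReal.rpow_add _ _ hV0 hVt]
        refine le_of_eq ?_
        congr 2
        field_simp; ring
      · refine le_trans (le_of_eq ?_) ((lintegral_hardy_rpow_neg_le hσ hy.le D.hardy_ne_top hV0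
          hα).trans (le_of_eq (by rw [one_div_div])))
        refine setLIntegral_congr_fun measurableSet_Ioi fun t ht => ?_
        rw [max_eq_right (hardy_mono σ (le_of_lt ht)), ← mul_assoc, ← ENNReal.rpow_neg_one,
          ← ENNReal.rpow_add _ _ (D.hardy_ne_zero t (hy.trans ht)) (D.hardy_ne_top t)]
        congr 2
        ring
    have hm : Measurable fun t => hardy σ t ^ (-((p - 1) / p)) * σ t := by fun_prop
    calc _ = ∫⁻ t in Ioi (0 : ℝ), ∫⁻ y in Ioi (0 : ℝ), g y *
            ((max (hardy σ y) (hardy σ t))⁻¹ * (hardy σ t ^ (-((p - 1) / p)) * σ t)) := by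
          refine lintegral_congr fun t => ?_
          rw [hL, ← lintegral_mul_const _ (by fun_prop)]
          simp only [mul_assoc]
      _ = ∫⁻ y in Ioi (0 : ℝ), ∫⁻ t in Ioi (0 : ℝ), g y *
            ((max (hardy σ y) (hardy σ t))⁻¹ * (hardy σ t ^ (-((p - 1) / p)) * σ t)) :=
          lintegral_lintegral_swap (by fun_prop)
      _ ≤ ∫⁻ y in Ioi (0 : ℝ), a * (h y ^ p * v y) := by
          refine setLIntegral_mono (by fun_prop) fun y hy => ?_
          rw [lintegral_const_mul _ (by fun_prop)]
          calc _ ≤ g y * (a * hardy σ y ^ (-((p - 1) / p))) := by gcongr; exact hinner y hy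
            _ = a * (h y ^ p * v y) * (hardy σ y ^ ((p - 1) / p) *
                  hardy σ y ^ (-((p - 1) / p))) := by simp only [hg]; ring
            _ = _ := by
                rw [← ENNReal.rpow_add _ _ (D.hardy_ne_zero y hy) (D.hardy_ne_top y)]; simp
      _ = _ := lintegral_const_mul _ (by fun_prop)
  have hr0 : 0 ≤ r / p := by positivity
  have hHL : ∀ t, 0 < t → hardy h t ^ r ≤ c ^ (r / p) * (L t ^ (r / p) * hardy σ t ^ e) := by
    intro t ht
    have hV0 := D.hardy_ne_zero t ht
    have hVt := D.hardy_ne_top t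
    calc hardy h t ^ r = (hardy h t ^ p) ^ (r / p) := by
          rw [← ENNReal.rpow_mul, mul_div_cancel₀ _ hp0.ne']
      _ ≤ (c * ((hardy σ t * L t) * hardy σ t ^ ((p - 1) * ((p - 1) / p)))) ^ (r / p) := by
          refine ENNReal.rpow_le_rpow ((D.hardy_rpow_le hp hh).trans ?_) hr0
          gcongr
          exact hGL t ht
      _ = (c * (L t * hardy σ t ^ ((p - 1) * ((p - 1) / p) + 1))) ^ (r / p) := by
          rw [ENNReal.rpow_add _ _ hV0 hVt, ENNReal.rpow_one]
          congr 1; ring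
      _ = _ := by
          rw [ENNReal.mul_rpow_of_nonneg _ _ hr0, ENNReal.mul_rpow_of_nonneg _ _ hr0,
            ← ENNReal.rpow_mul (hardy σ t)]
  set κ := (p - 1) * r / (p - r) with hκ
  have hκ0 : 0 < κ := by positivity
  calc ∫⁻ t in Ioi (0 : ℝ), hardy h t ^ r * u t
      ≤ ∫⁻ t in Ioi (0 : ℝ), c ^ (r / p) * ENNReal.ofReal e *
          (hardy (fun s => hardy σ s ^ (e - 1) * σ s) t * (L t ^ (r / p) * u t)) := by
        refine setLIntegral_mono (by fun_prop) fun t ht => ?_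
        refine (mul_le_mul' (hHL t ht) le_rfl).trans (le_of_eq ?_)
        rw [hardy_rpow_eq hσ (D.hardy_ne_top t) he0]
        simp only [hardy]
        ring
    _ = c ^ (r / p) * ENNReal.ofReal e *
          ∫⁻ s in Ioi (0 : ℝ), (hardy σ s ^ (e - 1) * σ s) *
            copson (fun t => L t ^ (r / p) * u t) s := by
        rw [lintegral_const_mul _ (by fun_prop), lintegral_hardy_mul (by fun_prop) (by fun_prop)]
    _ ≤ c ^ (r / p) * ENNReal.ofReal e *
          ∫⁻ s in Ioi (0 : ℝ), (L s * (hardy σ s ^ (-((p - 1) / p)) * σ s)) ^ (r / p) *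
            (copson u s ^ (p / (p - r)) * (hardy σ s ^ (κ - 1) * σ s)) ^ ((p - r) / p) := by
        refine mul_le_mul' le_rfl (setLIntegral_mono (by fun_prop) fun s hs => ?_)
        have hV0 := D.hardy_ne_zero s hs
        have hVt := D.hardy_ne_top s
        have h1 : copson (fun t => L t ^ (r / p) * u t) s ≤ L s ^ (r / p) * copson u s := by
          rw [copson, copson, ← lintegral_const_mul _ hu]
          refine setLIntegral_mono (by fun_prop) fun t ht => ?_
          gcongr
          exact hLanti (le_of_lt ht)
        have h2 : 0 ≤ (p - r) / p := by positivity
        refine (mul_le_mul' le_rfl h1).trans (le_of_eq ?_)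
        rw [ENNReal.mul_rpow_of_nonneg _ _ hr0, ENNReal.mul_rpow_of_nonneg _ _ hr0,
          ENNReal.mul_rpow_of_nonneg _ _ h2, ENNReal.mul_rpow_of_nonneg _ _ h2,
          ← ENNReal.rpow_mul, ← ENNReal.rpow_mul, ← ENNReal.rpow_mul]
        have e1 : p / (p - r) * ((p - r) / p) = 1 := by field_simp
        have e2 : e - 1 = -((p - 1) / p) * (r / p) + (κ - 1) * ((p - r) / p) := by
          rw [he, hκ]; field_simp; ring
        have e3 : σ s = σ s ^ (r / p) * σ s ^ ((p - r) / p) := by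
          rw [← ENNReal.rpow_add_of_nonneg _ _ hr0 h2, ← add_div, add_sub_cancel, div_self hp0.ne',
            ENNReal.rpow_one]
        rw [e1, ENNReal.rpow_one, e2, ENNReal.rpow_add _ _ hV0 hVt]
        nth_rw 1 [e3]
        ring
    _ ≤ c ^ (r / p) * ENNReal.ofReal e *
          ((∫⁻ s in Ioi (0 : ℝ), L s * (hardy σ s ^ (-((p - 1) / p)) * σ s)) ^ (r / p) *
            (∫⁻ s in Ioi (0 : ℝ), copson u s ^ (p / (p - r)) *
              (hardy σ s ^ (κ - 1) * σ s)) ^ ((p - r) / p)) := by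
        gcongr
        exact ENNReal.lintegral_mul_norm_pow_le (by fun_prop) (by fun_prop) hr0 (by positivity)
          (by field_simp; ring)
    _ ≤ c ^ (r / p) * ENNReal.ofReal e *
          ((a * ∫⁻ t in Ioi (0 : ℝ), h t ^ p * v t) ^ (r / p) *
            (b * ∫⁻ t in Ioi (0 : ℝ), copson u t ^ (r / (p - r)) * u t *
              hardy σ t ^ κ) ^ ((p - r) / p)) := by
        rw [lintegral_copson_rpow_mul_hardy_rpow hu hσ D.hardy_ne_top hufin (by positivity) hκ0]
        have e1 : p / (p - r) - 1 = r / (p - r) := by field_simp; ring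
        rw [e1]
        gcongr
    _ = _ := by
        rw [ENNReal.mul_rpow_of_nonneg _ _ hr0, ENNReal.mul_rpow_of_nonneg _ _ (by positivity)]
        ring

lemma DualPair.rpow_mul_eq_ae (D : DualPair p v σ) (hp : 1 < p) :
    ∀ᵐ x ∂volume.restrict (Ioi (0 : ℝ)), σ x ^ p * v x = σ x := by
  filter_upwards [D.ae_ne] with x hx
  have hp1 : 0 < p - 1 := by linarith
  rw [D.eq_rpow x, ← ENNReal.rpow_mul]
  nth_rw 2 [← ENNReal.rpow_one (v x)]
  rw [← ENNReal.rpow_add _ _ hx.1 hx.2]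
  congr 1
  field_simp; ring

lemma DualPair.bound_of_hardy_inequality (D : DualPair p v σ) (hp : 1 < p) (hr : 0 < r)
    (hrp : r < p) :
    ∃ K : ℝ≥0∞, K ≠ ∞ ∧ ∀ (u : ℝ → ℝ≥0∞) (E : ℝ≥0∞), Measurable u → copson u 0 ≠ ∞ →
      ∫⁻ t in Ioi (0 : ℝ), copson u t ^ (r / (p - r)) * u t *
            hardy σ t ^ ((p - 1) * r / (p - r)) ≠ ∞ →
      (∀ h : ℝ → ℝ≥0∞, Measurable h → E * ∫⁻ t in Ioi (0 : ℝ), hardy h t ^ r * u t ≤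
          (∫⁻ t in Ioi (0 : ℝ), h t ^ p * v t) ^ (r / p)) →
      E * (∫⁻ t in Ioi (0 : ℝ), copson u t ^ (r / (p - r)) * u t *
            hardy σ t ^ ((p - 1) * r / (p - r))) ^ ((p - r) / p) ≤ K := by
  have hp0 : 0 < p := by linarith
  have hp1 : 0 < p - 1 := by linarith
  have hpr : 0 < p - r := by linarith
  have hr0 : 0 ≤ r / p := by positivity
  have hv := D.measurable_left
  have hσ := D.measurable_right
  set κ := (p - 1) * r / (p - r) with hκ
  have hκ0 : 0 < κ := by positivity
  set ℓ := (p - 1) / (p - r) with hℓ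
  have hℓ0 : 0 < ℓ := by positivity
  set b := ENNReal.ofReal (p / (p - r) / κ) with hb
  set c := ENNReal.ofReal (1 / ℓ) ^ r with hc
  have hc0 : c ≠ 0 := by
    have : 0 < ENNReal.ofReal (1 / ℓ) := ENNReal.ofReal_pos.2 (by positivity)
    exact (ENNReal.rpow_pos this ENNReal.ofReal_ne_top).ne'
  have hct : c ≠ ∞ := ENNReal.rpow_ne_top_of_nonneg hr.le ENNReal.ofReal_ne_top
  refine ⟨b ^ (r / p) / c, ENNReal.div_ne_top (ENNReal.rpow_ne_top_of_nonneg hr0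
    ENNReal.ofReal_ne_top) hc0, ?_⟩
  intro u E hu hufin hBt hE
  set B := ∫⁻ t in Ioi (0 : ℝ), copson u t ^ (r / (p - r)) * u t * hardy σ t ^ κ with hB
  set h : ℝ → ℝ≥0∞ := fun s => copson u s ^ (1 / (p - r)) * (hardy σ s ^ (ℓ - 1) * σ s) with hh
  have hX : ∫⁻ t in Ioi (0 : ℝ), h t ^ p * v t = b * B := by
    have e1 : p / (p - r) - 1 = r / (p - r) := by field_simp; ring
    rw [hB, ← e1, hb, ← lintegral_copson_rpow_mul_hardy_rpow hu hσ D.hardy_ne_top hufin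
      (by positivity) hκ0]
    refine lintegral_congr_ae ?_
    filter_upwards [D.rpow_mul_eq_ae hp] with t ht
    have e2 : 1 / (p - r) * p = p / (p - r) := by ring
    have e3 : (ℓ - 1) * p = κ - 1 := by rw [hℓ, hκ]; field_simp; ring
    rw [hh]
    simp only
    rw [ENNReal.mul_rpow_of_nonneg _ _ hp0.le, ENNReal.mul_rpow_of_nonneg _ _ hp0.le,
      ← ENNReal.rpow_mul, ← ENNReal.rpow_mul, e2, e3, mul_assoc, mul_assoc, ht]
  have hH : c * B ≤ ∫⁻ t in Ioi (0 : ℝ), hardy h t ^ r * u t := by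
    rw [hB, ← lintegral_const_mul _ (by fun_prop)]
    refine setLIntegral_mono' measurableSet_Ioi fun t ht => ?_
    have h1 : copson u t ^ (1 / (p - r)) * (ENNReal.ofReal (1 / ℓ) * hardy σ t ^ ℓ) ≤
        hardy h t := by
      rw [← lintegral_hardy_rpow hσ (D.hardy_ne_top t) hℓ0, ← lintegral_const_mul _ (by fun_prop)]
      refine setLIntegral_mono' measurableSet_Ioc fun s hs => ?_
      have := copson_anti u hs.2
      rw [hh]
      dsimp only
      gcongr
    refine le_trans (le_of_eq ?_) (mul_le_mul' (ENNReal.rpow_le_rpow h1 hr.le) le_rfl)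
    have e2 : 1 / (p - r) * r = r / (p - r) := by ring
    have e3 : ℓ * r = κ := by rw [hℓ, hκ]; ring
    rw [ENNReal.mul_rpow_of_nonneg _ _ hr.le, ENNReal.mul_rpow_of_nonneg _ _ hr.le,
      ← ENNReal.rpow_mul, ← ENNReal.rpow_mul, e2, e3]
    ring
  have hmain := (mul_le_mul' (le_refl E) hH).trans (hE h (by fun_prop))
  rw [hX, ENNReal.mul_rpow_of_nonneg _ _ hr0] at hmain
  rcases eq_or_ne B 0 with hB0 | hB0
  · rw [hB0, ENNReal.zero_rpow_of_pos (by positivity), mul_zero]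
    exact zero_le
  rw [ENNReal.le_div_iff_mul_le (Or.inl hc0) (Or.inl hct)]
  have h3 : B ^ (r / p) ≠ 0 := by simp [ENNReal.rpow_eq_zero_iff, hB0, hBt]
  have h4 : B ^ (r / p) ≠ ∞ := by simp [ENNReal.rpow_eq_top_iff, hB0, hBt]
  rw [← ENNReal.mul_le_mul_iff_left h3 h4]
  refine le_trans (le_of_eq ?_) hmain
  have : B = B ^ ((p - r) / p) * B ^ (r / p) := by
    rw [← ENNReal.rpow_add _ _ hB0 hBt, ← add_div, sub_add_cancel, div_self hp0.ne',
      ENNReal.rpow_one]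
  nth_rw 3 [this]
  ring

lemma lintegral_mul_hardy_rpow_le {w φ : ℝ → ℝ≥0∞} (hw : Measurable w) (hφ : Measurable φ)
    (hfin : ∀ c, hardy w c ≠ ∞) {x : ℝ} (hx : 0 < x) (h0 : hardy w x ≠ 0) {e : ℝ} (he : 0 < e)
    {M : ℝ≥0∞} (hM : ∀ y, x ≤ y → copson φ y ≤ M * hardy w y ^ (-(2 * e))) :
    ∫⁻ t in Ioi x, φ t * hardy w t ^ e ≤ 2 * M * hardy w x ^ (-e) := by
  have hne : ∀ t, x ≤ t → hardy w t ≠ 0 := fun t ht h =>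
    h0 (nonpos_iff_eq_zero.1 (h ▸ hardy_mono w ht))
  have h1 : ∀ t ∈ Ioi x, φ t * hardy w t ^ e = hardy w x ^ e * φ t +
      ENNReal.ofReal e * ((∫⁻ s in Ioc x t, hardy w s ^ (e - 1) * w s) * φ t) := by
    intro t ht
    rw [hardy_rpow_eq hw (hfin t) he, hardy_rpow_eq hw (hfin x) he,
      lintegral_Ioc_add hx.le (le_of_lt ht)]
    ring
  have hm : Measurable fun t => ∫⁻ s in Ioc x t, hardy w s ^ (e - 1) * w s :=
    Monotone.measurable fun _ _ h => lintegral_mono_set (Ioc_subset_Ioc_right h)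
  rw [setLIntegral_congr_fun measurableSet_Ioi h1, lintegral_add_left (by fun_prop),
    lintegral_const_mul _ hφ, lintegral_const_mul _ (by fun_prop),
    lintegral_Ioi_lintegral_Ioc_mul (by fun_prop) hφ]
  have h2 : hardy w x ^ e * ∫⁻ t in Ioi x, φ t ≤ M * hardy w x ^ (-e) := by
    calc _ ≤ hardy w x ^ e * (M * hardy w x ^ (-(2 * e))) := by gcongr; exact hM x le_rfl
      _ = _ := by
        rw [mul_left_comm, ← ENNReal.rpow_add _ _ h0 (hfin x)]
        congr 2; ring
  have h3 : ENNReal.ofReal e * ∫⁻ s in Ioi x, hardy w s ^ (e - 1) * w s * ∫⁻ t in Ioi s, φ t ≤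
      M * hardy w x ^ (-e) := by
    calc _ ≤ ENNReal.ofReal e * ∫⁻ s in Ioi x, M * (hardy w s ^ (-e - 1) * w s) := by
          refine mul_le_mul' le_rfl (setLIntegral_mono (by fun_prop) fun s hs => ?_)
          have hs' : x ≤ s := le_of_lt hs
          refine (mul_le_mul' le_rfl (hM s hs')).trans (le_of_eq ?_)
          have : -e - 1 = (e - 1) + (-(2 * e)) := by ring
          rw [this, ENNReal.rpow_add _ _ (hne s hs') (hfin s)]
          ring
      _ ≤ ENNReal.ofReal e * (M * (ENNReal.ofReal (1 / e) * hardy w x ^ (-e))) := by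
          rw [lintegral_const_mul _ (by fun_prop)]
          gcongr
          exact lintegral_hardy_rpow_neg_le hw hx.le hfin h0 he
      _ = (ENNReal.ofReal e * ENNReal.ofReal (1 / e)) * (M * hardy w x ^ (-e)) := by ring
      _ = _ := by
          rw [← ENNReal.ofReal_mul he.le, mul_one_div_cancel he.ne', ENNReal.ofReal_one, one_mul]
  calc _ ≤ M * hardy w x ^ (-e) + M * hardy w x ^ (-e) := add_le_add h2 h3
    _ = _ := by ring

lemma lintegral_Ioi_rpow_lintegral_Ioc_le (hp : 0 < p) (hr : 0 < r) (hpq : p ≤ q)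
    {u w v h : ℝ → ℝ≥0∞} (hu : Measurable u) (hw : Measurable w) (hv : Measurable v)
    (hh : Measurable h) (hfin : ∀ c, hardy w c ≠ ∞) (h0 : ∀ x, 0 < x → hardy w x ≠ 0) {D : ℝ≥0∞}
    (hD : ∀ k : ℝ → ℝ≥0∞, Measurable k → ∀ y, 0 < y → ∫⁻ t in Ioi y, hardy k t ^ r * u t ≤
      D * hardy w y ^ (-(r / q)) * (∫⁻ t in Ioi (0 : ℝ), k t ^ p * v t) ^ (r / p)) :
    ∫⁻ x in Ioi (0 : ℝ), (∫⁻ t in Ioi x, (∫⁻ s in Ioc x t, h s) ^ r * u t) ^ (q / r) * w x ≤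
      (2 * D) ^ (q / r) * 2 * (∫⁻ t in Ioi (0 : ℝ), h t ^ p * v t) ^ (q / p) := by
  have hq : 0 < q := hp.trans_le hpq
  have hθ : 1 ≤ q / p := by rwa [one_le_div hp]
  have hqr : 0 < q / r := by positivity
  have hqp : 0 < q / p := by positivity
  set f : ℝ → ℝ≥0∞ := fun s => h s ^ p * hardy w s ^ (-(p / (2 * q))) * v s with hf
  have hfm : Measurable f := by fun_prop
  have hψ : ∀ x, 0 < x → ∫⁻ t in Ioi x, (∫⁻ s in Ioc x t, h s) ^ r * u t ≤
      2 * (D * copson f x ^ (r / p)) * hardy w x ^ (-(r / (2 * q))) := by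
    intro x hx
    set k : ℝ → ℝ≥0∞ := (Ioi x).indicator fun s => h s * hardy w s ^ (-(1 / (2 * q))) with hk
    have hkm : Measurable k := Measurable.indicator (by fun_prop) measurableSet_Ioi
    have hX : ∫⁻ t in Ioi (0 : ℝ), k t ^ p * v t = copson f x := by
      have : ∀ t, k t ^ p * v t = (Ioi x).indicator f t := by
        intro t
        by_cases ht : t ∈ Ioi x
        · rw [hk, indicator_of_mem ht, indicator_of_mem ht, ENNReal.mul_rpow_of_nonneg _ _ hp.le,
            ← ENNReal.rpow_mul, hf]
          have e1 : -(1 / (2 * q)) * p = -(p / (2 * q)) := by ring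
          rw [e1]
        · rw [hk, indicator_of_notMem ht, indicator_of_notMem ht, ENNReal.zero_rpow_of_pos hp,
            zero_mul]
      simp only [this]
      rw [lintegral_indicator measurableSet_Ioi, Measure.restrict_restrict measurableSet_Ioi,
        inter_eq_left.2 (Ioi_subset_Ioi hx.le), copson]
    have hle : ∀ t ∈ Ioi x, (∫⁻ s in Ioc x t, h s) ^ r * u t ≤
        (hardy k t ^ r * u t) * hardy w t ^ (r / (2 * q)) := by
      intro t ht
      have h1 : ∫⁻ s in Ioc x t, h s ≤ hardy w t ^ (1 / (2 * q)) * hardy k t := by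
        calc _ ≤ ∫⁻ s in Ioc x t, hardy w t ^ (1 / (2 * q)) * k s := by
              refine setLIntegral_mono (by fun_prop) fun s hs => ?_
              rw [hk, indicator_of_mem (show s ∈ Ioi x from hs.1)]
              calc h s = hardy w s ^ (1 / (2 * q)) * (h s * hardy w s ^ (-(1 / (2 * q)))) := by
                    rw [mul_left_comm, ← ENNReal.rpow_add _ _ (h0 s (hx.trans hs.1)) (hfin s)]
                    simp
                _ ≤ _ := by
                    have := hardy_mono w hs.2
                    gcongr
          _ = hardy w t ^ (1 / (2 * q)) * ∫⁻ s in Ioc x t, k s := lintegral_const_mul _ hkm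
          _ ≤ _ := mul_le_mul' le_rfl (lintegral_mono_set (Ioc_subset_Ioc_left hx.le))
      have h2 := ENNReal.rpow_le_rpow h1 hr.le
      rw [ENNReal.mul_rpow_of_nonneg _ _ hr.le, ← ENNReal.rpow_mul, one_div_mul_eq_div] at h2
      calc _ ≤ hardy w t ^ (r / (2 * q)) * hardy k t ^ r * u t := by gcongr
        _ = _ := by ring
    refine (setLIntegral_mono (by fun_prop) hle).trans (lintegral_mul_hardy_rpow_le hw
      (by fun_prop) hfin hx (h0 x hx) (by positivity) fun y hy => ?_)
    refine (hD k hkm y (hx.trans_le hy)).trans (le_of_eq ?_)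
    have e1 : -(2 * (r / (2 * q))) = -(r / q) := by field_simp
    rw [hX, e1]
    ring
  calc _ ≤ ∫⁻ x in Ioi (0 : ℝ), (2 * D) ^ (q / r) *
          (copson f x ^ (q / p) * (hardy w x ^ ((1 / 2 : ℝ) - 1) * w x)) := by
        refine setLIntegral_mono (by fun_prop) fun x hx => ?_
        have h1 := ENNReal.rpow_le_rpow (hψ x hx) hqr.le
        rw [← mul_assoc, ENNReal.mul_rpow_of_nonneg _ _ hqr.le,
          ENNReal.mul_rpow_of_nonneg _ _ hqr.le, ← ENNReal.rpow_mul, ← ENNReal.rpow_mul] at h1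
        have e1 : r / p * (q / r) = q / p := by field_simp
        have e2 : -(r / (2 * q)) * (q / r) = 1 / 2 - 1 := by field_simp; norm_num
        rw [e1, e2] at h1
        refine (mul_le_mul' h1 le_rfl).trans (le_of_eq (by ring))
    _ ≤ (2 * D) ^ (q / r) * (∫⁻ s in Ioi (0 : ℝ), f s *
          (∫⁻ t in Ioc 0 s, hardy w t ^ ((1 / 2 : ℝ) - 1) * w t) ^ (1 / (q / p))) ^ (q / p) := by
        rw [lintegral_const_mul _ (by fun_prop)]
        gcongr
        exact lintegral_rpow_lintegral_Ioi_le (g := fun t => hardy w t ^ ((1 / 2 : ℝ) - 1) * w t)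
          hfm (by fun_prop) hθ
    _ = (2 * D) ^ (q / r) * (∫⁻ s in Ioi (0 : ℝ), 2 ^ (p / q) * (h s ^ p * v s)) ^ (q / p) := by
        congr 2
        refine setLIntegral_congr_fun measurableSet_Ioi fun s hs => ?_
        have e1 : (1 / 2 : ℝ) * (p / q) = p / (2 * q) := by field_simp
        rw [lintegral_hardy_rpow hw (hfin s) (by norm_num), one_div_one_div, one_div_div,
          ENNReal.mul_rpow_of_nonneg _ _ (by positivity), ← ENNReal.rpow_mul, e1, ENNReal.ofReal_ofNat]
        calc _ = 2 ^ (p / q) * (h s ^ p * v s) *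
              (hardy w s ^ (p / (2 * q)) * hardy w s ^ (-(p / (2 * q)))) := by
              simp only [hf]; ring
          _ = _ := by rw [← ENNReal.rpow_add _ _ (h0 s hs) (hfin s)]; simp
    _ = _ := by
        rw [lintegral_const_mul _ (by fun_prop), ENNReal.mul_rpow_of_nonneg _ _ hqp.le,
          ← ENNReal.rpow_mul]
        have e1 : p / q * (q / p) = 1 := by field_simp
        rw [e1, ENNReal.rpow_one, mul_assoc]

lemma setLIntegral_ne_zero {f : ℝ → ℝ≥0∞} {s : Set ℝ} (hf : Measurable f) (hs : volume s ≠ 0)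
    (h : ∀ᵐ x ∂volume.restrict s, f x ≠ 0) : ∫⁻ x in s, f x ≠ 0 := by
  intro h0
  rw [lintegral_eq_zero_iff hf] at h0
  have : ∀ᵐ _ ∂volume.restrict s, False := by
    filter_upwards [h, h0] with x hx hx0 using hx hx0
  rw [ae_iff] at this
  simp [hs] at this

lemma hardy_ne_zero_of_ae {f : ℝ → ℝ≥0∞} (hf : Measurable f)
    (h : ∀ᵐ x ∂volume.restrict (Ioi (0 : ℝ)), f x ≠ 0) {x : ℝ} (hx : 0 < x) : hardy f x ≠ 0 :=
  setLIntegral_ne_zero hf (by simp [hx])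
    (ae_restrict_of_ae_restrict_of_subset Ioc_subset_Ioi_self h)

lemma copson_ne_zero_of_ae {f : ℝ → ℝ≥0∞} (hf : Measurable f)
    (h : ∀ᵐ x ∂volume.restrict (Ioi (0 : ℝ)), f x ≠ 0) {x : ℝ} (hx : 0 ≤ x) : copson f x ≠ 0 :=
  setLIntegral_ne_zero hf (by simp)
    (ae_restrict_of_ae_restrict_of_subset (Ioi_subset_Ioi hx) h)

lemma copson_ne_top_of_copson_rpow_mul {u w : ℝ → ℝ≥0∞} (hw : Measurable w)
    (hw0 : ∀ᵐ x ∂volume.restrict (Ioi (0 : ℝ)), w x ≠ 0) {e : ℝ} (he : 0 < e)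
    (h : ∀ x, 0 < x → copson (fun t => copson u t ^ e * w t) x ≠ ∞) {x : ℝ} (hx : 0 < x) :
    copson u x ≠ ∞ := by
  intro htop
  refine h (x / 2) (by linarith) (top_le_iff.1 ?_)
  have hne : ∫⁻ t in Ioc (x / 2) x, w t ≠ 0 :=
    setLIntegral_ne_zero hw (by simp [hx])
      (ae_restrict_of_ae_restrict_of_subset (fun t ht => by
        have := ht.1; simp only [mem_Ioi]; linarith) hw0)
  calc ∞ = ∞ * ∫⁻ t in Ioc (x / 2) x, w t := (ENNReal.top_mul hne).symm
    _ = ∫⁻ t in Ioc (x / 2) x, ∞ * w t := (lintegral_const_mul _ hw).symm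
    _ ≤ ∫⁻ t in Ioc (x / 2) x, copson u t ^ e * w t := by
        refine setLIntegral_mono (by fun_prop) fun t ht => ?_
        rw [top_le_iff.1 (htop.ge.trans (copson_anti u ht.2)), ENNReal.top_rpow_of_pos he]
    _ ≤ _ := lintegral_mono_set Ioc_subset_Ioi_self

lemma copson_indicator_Ioi (u : ℝ → ℝ≥0∞) (a t : ℝ) :
    copson ((Ioi a).indicator u) t = copson u (max a t) := by
  rw [copson, lintegral_indicator measurableSet_Ioi, Measure.restrict_restrict measurableSet_Ioi,
    Ioi_inter_Ioi, copson]

lemma DualPair.copson_rpow_mul_le (D : DualPair p v σ) (hp : 1 < p) (hq : 0 < q) (hr : 0 < r)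
    {u w : ℝ → ℝ≥0∞} (hu : Measurable u) (hw : Measurable w) {C : ℝ≥0∞}
    (hC : ∀ h : ℝ → ℝ≥0∞, Measurable h →
      (∫⁻ x in Ioi (0 : ℝ), (∫⁻ t in Ioi x, hardy h t ^ r * u t) ^ (q / r) * w x) ^ (1 / q) ≤
        C * (∫⁻ t in Ioi (0 : ℝ), h t ^ p * v t) ^ (1 / p)) {x : ℝ} (hx : 0 < x) :
    copson (fun t => copson u t ^ (q / r) * w t) x ^ (1 / q) * hardy σ x ^ ((p - 1) / p) ≤ C := by
  have hp0 : 0 < p := by linarith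
  have hV0 := D.hardy_ne_zero x hx
  have hVt := D.hardy_ne_top x
  have hσ := D.measurable_right
  have hqr : 0 < q / r := by positivity
  have hX : ∫⁻ t in Ioi (0 : ℝ), (Ioc 0 x).indicator σ t ^ p * v t = hardy σ x := by
    have : ∀ t, (Ioc 0 x).indicator σ t ^ p * v t =
        (Ioc 0 x).indicator (fun t => σ t ^ p * v t) t := by
      intro t
      by_cases ht : t ∈ Ioc 0 x
      · rw [indicator_of_mem ht, indicator_of_mem ht]
      · rw [indicator_of_notMem ht, indicator_of_notMem ht, ENNReal.zero_rpow_of_pos hp0, zero_mul]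
    simp only [this]
    rw [lintegral_indicator measurableSet_Ioc, Measure.restrict_restrict measurableSet_Ioc,
      inter_eq_left.2 Ioc_subset_Ioi_self]
    exact lintegral_congr_ae
      (ae_restrict_of_ae_restrict_of_subset Ioc_subset_Ioi_self (D.rpow_mul_eq_ae hp))
  have hH : ∀ t, x ≤ t → hardy ((Ioc 0 x).indicator σ) t = hardy σ x := by
    intro t ht
    rw [hardy, lintegral_indicator measurableSet_Ioc, Measure.restrict_restrict measurableSet_Ioc,
      inter_eq_left.2 (Ioc_subset_Ioc_right ht), hardy]
  have h1 := hC _ (hσ.indicator (measurableSet_Ioc (a := 0) (b := x)))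
  rw [hX] at h1
  have h2 : hardy σ x ^ q * copson (fun t => copson u t ^ (q / r) * w t) x ≤
      ∫⁻ y in Ioi (0 : ℝ), (∫⁻ t in Ioi y, hardy ((Ioc 0 x).indicator σ) t ^ r * u t) ^ (q / r) *
        w y := by
    rw [copson, ← lintegral_const_mul _ (by fun_prop)]
    refine le_trans ?_ (lintegral_mono_set (Ioi_subset_Ioi hx.le))
    refine le_of_eq (setLIntegral_congr_fun measurableSet_Ioi fun y hy => ?_)
    have h3 : ∫⁻ t in Ioi y, hardy ((Ioc 0 x).indicator σ) t ^ r * u t =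
        hardy σ x ^ r * copson u y := by
      rw [copson, ← lintegral_const_mul _ hu]
      refine setLIntegral_congr_fun measurableSet_Ioi fun t ht => ?_
      rw [hH t (le_of_lt (lt_trans hy ht))]
    rw [h3, ENNReal.mul_rpow_of_nonneg _ _ hqr.le, ← ENNReal.rpow_mul, mul_div_cancel₀ _ hr.ne',
      mul_assoc]
  have h3 := (ENNReal.rpow_le_rpow h2 (by positivity : 0 ≤ 1 / q)).trans h1
  rw [ENNReal.mul_rpow_of_nonneg _ _ (by positivity), ← ENNReal.rpow_mul,
    mul_one_div_cancel hq.ne', ENNReal.rpow_one] at h3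
  have hVp0 : hardy σ x ^ (1 / p) ≠ 0 := by simp [ENNReal.rpow_eq_zero_iff, hV0, hVt]
  have hVpt : hardy σ x ^ (1 / p) ≠ ∞ := by simp [ENNReal.rpow_eq_top_iff, hV0, hVt]
  rw [← ENNReal.mul_le_mul_iff_left hVp0 hVpt]
  refine le_trans (le_of_eq ?_) h3
  rw [mul_assoc, ← ENNReal.rpow_add _ _ hV0 hVt, ← add_div, sub_add_cancel, div_self hp0.ne',
    ENNReal.rpow_one, mul_comm]

open Filter Topology in
lemma DualPair.exists_hardy_rpow_mul_le (D : DualPair p v σ) (hp : 1 < p) (hq : 0 < q)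
    (hr : 0 < r) (hrp : r < p)
    {u w : ℝ → ℝ≥0∞} (hu : Measurable u) (hw : Measurable w)
    (hu0 : ∀ᵐ x ∂volume.restrict (Ioi (0 : ℝ)), u x ≠ ∞)
    (hufin : ∀ x, 0 < x → copson u x ≠ ∞) {C : ℝ≥0∞} (hC0 : C ≠ 0) (hCt : C ≠ ∞)
    (hC : ∀ h : ℝ → ℝ≥0∞, Measurable h →
      (∫⁻ x in Ioi (0 : ℝ), (∫⁻ t in Ioi x, hardy h t ^ r * u t) ^ (q / r) * w x) ^ (1 / q) ≤
        C * (∫⁻ t in Ioi (0 : ℝ), h t ^ p * v t) ^ (1 / p)) :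
    ∃ F : ℝ≥0∞, F ≠ ∞ ∧ ∀ y, 0 < y → hardy w y ^ (1 / q) *
      (∫⁻ t in Ioi y, copson u t ^ (r / (p - r)) * u t *
        hardy σ t ^ ((p - 1) * r / (p - r))) ^ ((p - r) / (p * r)) ≤ F := by
  have hp0 : 0 < p := by linarith
  have hp1 : 0 < p - 1 := by linarith
  have hpr : 0 < p - r := by linarith
  have hσ := D.measurable_right
  set κ := (p - 1) * r / (p - r) with hκ
  have hκ0 : 0 < κ := by positivity
  have hd : 0 < r / (p - r) := by positivity
  have hθ : 0 < (p - r) / p := by positivity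
  obtain ⟨K, hK, hKB⟩ := D.bound_of_hardy_inequality hp hr hrp
  have hCr0 : C ^ r ≠ 0 := by simp [ENNReal.rpow_eq_zero_iff, hC0, hCt]
  have hCrt : C ^ r ≠ ∞ := ENNReal.rpow_ne_top_of_nonneg hr.le hCt
  refine ⟨(K * C ^ r) ^ (1 / r), ENNReal.rpow_ne_top_of_nonneg (by positivity)
    (ENNReal.mul_ne_top hK hCrt), fun y hy => ?_⟩
  have hbase : ∀ h : ℝ → ℝ≥0∞, Measurable h →
      hardy w y ^ (r / q) * (∫⁻ t in Ioi y, hardy h t ^ r * u t) ≤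
        C ^ r * (∫⁻ t in Ioi (0 : ℝ), h t ^ p * v t) ^ (r / p) := by
    intro h hh
    have h1 : (∫⁻ t in Ioi y, hardy h t ^ r * u t) ^ (q / r) * hardy w y ≤
        ∫⁻ x in Ioi (0 : ℝ), (∫⁻ t in Ioi x, hardy h t ^ r * u t) ^ (q / r) * w x := by
      rw [hardy, ← lintegral_const_mul _ hw]
      refine le_trans ?_ (lintegral_mono_set (show Ioc 0 y ⊆ Ioi 0 from Ioc_subset_Ioi_self))
      refine setLIntegral_mono' measurableSet_Ioc fun x hx => ?_
      have := lintegral_mono_set (μ := volume) (f := fun t => hardy h t ^ r * u t)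
        (Ioi_subset_Ioi hx.2)
      gcongr
    have h2 := ENNReal.rpow_le_rpow
      ((ENNReal.rpow_le_rpow h1 (by positivity : 0 ≤ 1 / q)).trans (hC h hh)) hr.le
    rw [← ENNReal.rpow_mul, ENNReal.mul_rpow_of_nonneg _ _ (by positivity),
      ENNReal.mul_rpow_of_nonneg _ _ hr.le, ← ENNReal.rpow_mul, ← ENNReal.rpow_mul,
      one_div_mul_eq_div, one_div_mul_eq_div, div_mul_div_cancel₀ hr.ne', div_self hq.ne',
      ENNReal.rpow_one, mul_comm] at h2
    exact h2
  set û : ℕ → ℝ → ℝ≥0∞ := fun N => (Ioc y N).indicator u with hû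
  have hûm : ∀ N, Measurable (û N) := fun N => hu.indicator measurableSet_Ioc
  have hûle : ∀ N t, û N t ≤ (Ioi y).indicator u t := fun N t =>
    indicator_le_indicator_of_subset Ioc_subset_Ioi_self (fun _ => zero_le) t
  have hcop : ∀ N t, copson (û N) t ≤ copson u y := fun N t => by
    refine (lintegral_mono (hûle N)).trans ?_
    rw [← copson, copson_indicator_Ioi]
    exact copson_anti u (le_max_left _ _)
  have hE : ∀ N, hardy w y ^ (r / q) / C ^ r * (∫⁻ t in Ioi (0 : ℝ),
      copson (û N) t ^ (r / (p - r)) * û N t * hardy σ t ^ κ) ^ ((p - r) / p) ≤ K := by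
    intro N
    refine hKB _ _ (hûm N) (ne_top_of_le_ne_top (hufin y hy) (hcop N 0)) ?_ ?_
    · have hle : ∫⁻ t in Ioi (0 : ℝ), copson (û N) t ^ (r / (p - r)) * û N t * hardy σ t ^ κ ≤
          (copson u y ^ (r / (p - r)) * hardy σ N ^ κ) * copson u y := by
        calc _ ≤ ∫⁻ t in Ioi (0 : ℝ), (copson u y ^ (r / (p - r)) * hardy σ N ^ κ) * û N t := by
              refine lintegral_mono fun t => ?_
              have h1 := hcop N t
              by_cases ht : t ∈ Ioc y N
              · have h2 := hardy_mono σ ht.2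
                rw [mul_right_comm]
                gcongr
              · simp [hû, indicator_of_notMem ht]
          _ = (copson u y ^ (r / (p - r)) * hardy σ N ^ κ) * copson (û N) 0 :=
              lintegral_const_mul _ (hûm N)
          _ ≤ _ := by gcongr; exact hcop N 0
      refine ne_top_of_le_ne_top ?_ hle
      have := hufin y hy
      exact ENNReal.mul_ne_top (ENNReal.mul_ne_top (ENNReal.rpow_ne_top_of_nonneg hd.le this)
        (ENNReal.rpow_ne_top_of_nonneg hκ0.le (D.hardy_ne_top _))) this
    · intro h hh
      have h1 : ∫⁻ t in Ioi (0 : ℝ), hardy h t ^ r * û N t ≤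
          ∫⁻ t in Ioi y, hardy h t ^ r * u t := by
        calc _ ≤ ∫⁻ t in Ioi (0 : ℝ), (Ioi y).indicator (fun t => hardy h t ^ r * u t) t := by
              refine lintegral_mono fun t => (mul_le_mul' le_rfl (hûle N t)).trans ?_
              by_cases ht : t ∈ Ioi y
              · simp only [indicator_of_mem ht, le_refl]
              · simp [indicator_of_notMem ht]
          _ = _ := by
              rw [lintegral_indicator measurableSet_Ioi,
                Measure.restrict_restrict measurableSet_Ioi,
                inter_eq_left.2 (Ioi_subset_Ioi hy.le)]
      rw [ENNReal.mul_div_right_comm.symm]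
      refine ENNReal.div_le_of_le_mul ?_
      refine ((mul_le_mul' le_rfl h1).trans (hbase h hh)).trans (le_of_eq (mul_comm _ _))
  set S : ℕ → ℝ → ℝ≥0∞ := fun N t => copson (û N) t ^ (r / (p - r)) * û N t * hardy σ t ^ κ
    with hS
  have hûmono : Monotone û := fun M N hMN t =>
    indicator_le_indicator_of_subset (Ioc_subset_Ioc_right (by exact_mod_cast hMN))
      (fun _ => zero_le) t
  have hSmono : Monotone S := fun M N hMN t => by
    have h1 := hûmono hMN t
    have h2 : copson (û M) t ≤ copson (û N) t := lintegral_mono (hûmono hMN)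
    simp only [hS]
    gcongr
  set û' : ℝ → ℝ≥0∞ := (Ioi y).indicator u with hû'
  have hûlim : ∀ t, ∀ᶠ N in atTop, û N t = û' t := by
    intro t
    obtain ⟨N, hN⟩ := exists_nat_ge t
    filter_upwards [eventually_ge_atTop N] with M hM
    have : t ≤ M := hN.trans (by exact_mod_cast hM)
    simp [hû, hû', indicator, this]
  have hcoplim : ∀ t, Tendsto (fun N => copson (û N) t) atTop (𝓝 (copson û' t)) := fun t =>
    lintegral_tendsto_of_tendsto_of_monotone (fun N => (hûm N).aemeasurable)
      (.of_forall fun s _ _ hMN => hûmono hMN s)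
      (.of_forall fun s => tendsto_nhds_of_eventually_eq (hûlim s))
  have hSlim : Tendsto (fun N => ∫⁻ t in Ioi (0 : ℝ), S N t) atTop
      (𝓝 (∫⁻ t in Ioi (0 : ℝ), copson û' t ^ (r / (p - r)) * (û' t * hardy σ t ^ κ))) := by
    refine lintegral_tendsto_of_tendsto_of_monotone (fun N => ?_)
      (.of_forall fun s _ _ hMN => hSmono hMN s) ?_
    · have := hûm N
      exact Measurable.aemeasurable (by fun_prop)
    filter_upwards [hu0] with t ht
    have hne : û' t * hardy σ t ^ κ ≠ ∞ := by
      refine ENNReal.mul_ne_top ?_ (ENNReal.rpow_ne_top_of_nonneg hκ0.le (D.hardy_ne_top t))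
      exact ne_top_of_le_ne_top ht (indicator_le_self _ _ _)
    refine (ENNReal.Tendsto.mul_const ((hcoplim t).ennrpow_const _) (Or.inr hne)).congr' ?_
    filter_upwards [hûlim t] with N hN
    simp only [hS]
    rw [hN, mul_assoc]
  have hBlim : ∫⁻ t in Ioi (0 : ℝ), copson û' t ^ (r / (p - r)) * (û' t * hardy σ t ^ κ) =
      ∫⁻ t in Ioi y, copson u t ^ (r / (p - r)) * u t * hardy σ t ^ κ := by
    have : ∀ t, copson û' t ^ (r / (p - r)) * (û' t * hardy σ t ^ κ) = (Ioi y).indicator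
        (fun t => copson u t ^ (r / (p - r)) * u t * hardy σ t ^ κ) t := by
      intro t
      by_cases ht : t ∈ Ioi y
      · rw [indicator_of_mem ht, hû', copson_indicator_Ioi, max_eq_right (le_of_lt ht),
          indicator_of_mem ht, mul_assoc]
      · rw [indicator_of_notMem ht, hû', indicator_of_notMem ht, zero_mul, mul_zero]
    simp only [this]
    rw [lintegral_indicator measurableSet_Ioi, Measure.restrict_restrict measurableSet_Ioi,
      inter_eq_left.2 (Ioi_subset_Ioi hy.le)]
  rw [hBlim] at hSlim
  set B := ∫⁻ t in Ioi y, copson u t ^ (r / (p - r)) * u t * hardy σ t ^ κ with hB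
  have hmain : hardy w y ^ (r / q) / C ^ r * B ^ ((p - r) / p) ≤ K := by
    have hmono : Monotone fun N => (∫⁻ t in Ioi (0 : ℝ), S N t) ^ ((p - r) / p) :=
      fun M N hMN => ENNReal.rpow_le_rpow (lintegral_mono (hSmono hMN)) hθ.le
    rw [← iSup_eq_of_tendsto hmono (hSlim.ennrpow_const _), ENNReal.mul_iSup]
    exact iSup_le hE
  rw [← ENNReal.mul_div_right_comm, ENNReal.div_le_iff hCr0 hCrt] at hmain
  refine le_trans (le_of_eq ?_) (ENNReal.rpow_le_rpow hmain (by positivity : 0 ≤ 1 / r))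
  rw [ENNReal.mul_rpow_of_nonneg _ _ (by positivity), ← ENNReal.rpow_mul, ← ENNReal.rpow_mul]
  congr 2 <;> field_simp

lemma ENNReal.add_rpow_le_two_rpow_mul (a b : ℝ≥0∞) {e : ℝ} (he : 0 ≤ e) :
    (a + b) ^ e ≤ 2 ^ e * (a ^ e + b ^ e) := by
  rcases le_total a b with h | h
  · calc (a + b) ^ e ≤ (2 * b) ^ e := by rw [two_mul]; gcongr
      _ = 2 ^ e * b ^ e := ENNReal.mul_rpow_of_nonneg _ _ he
      _ ≤ _ := by gcongr; exact le_add_self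
  · calc (a + b) ^ e ≤ (2 * a) ^ e := by rw [two_mul]; gcongr
      _ = 2 ^ e * a ^ e := ENNReal.mul_rpow_of_nonneg _ _ he
      _ ≤ _ := by gcongr; exact le_self_add

lemma hardy_ne_top_of_hardy_rpow_mul {u w σ : ℝ → ℝ≥0∞} (hu : Measurable u)
    (hu0 : ∀ᵐ x ∂volume.restrict (Ioi (0 : ℝ)), u x ≠ 0) (hufin : ∀ x, 0 < x → copson u x ≠ ∞)
    (hσfin : ∀ x, hardy σ x ≠ ∞) (hσ0 : ∀ x, 0 < x → hardy σ x ≠ 0) {a b c d : ℝ} (ha : 0 < a)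
    (hb : 0 ≤ b) {F : ℝ≥0∞} (hF : F ≠ ∞)
    (h : ∀ y, 0 < y → hardy w y ^ a *
      (∫⁻ t in Ioi y, copson u t ^ c * u t * hardy σ t ^ d) ^ b ≤ F) (y : ℝ) :
    hardy w y ≠ ∞ := by
  rcases le_or_gt y 0 with hy | hy
  · simp [hardy, Ioc_eq_empty (not_lt.2 hy)]
  intro htop
  have hB : ∫⁻ t in Ioi y, copson u t ^ c * u t * hardy σ t ^ d ≠ 0 := by
    refine setLIntegral_ne_zero (by fun_prop) (by simp) ?_
    filter_upwards [ae_restrict_mem measurableSet_Ioi,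
      ae_restrict_of_ae_restrict_of_subset (Ioi_subset_Ioi hy.le) hu0] with t ht hut
    have ht0 : 0 < t := hy.trans ht
    have := copson_ne_zero_of_ae hu hu0 ht0.le
    simp [ENNReal.rpow_eq_zero_iff, hufin t ht0, hut, hσfin t, hσ0 t ht0, this]
  have h1 := h y hy
  rw [htop, ENNReal.top_rpow_of_pos ha, ENNReal.top_mul] at h1
  · exact hF (top_le_iff.1 h1)
  · simp [ENNReal.rpow_eq_zero_iff, hB, hb, not_lt.2]

lemma DualPair.lintegral_Ioi_hardy_rpow_le (D : DualPair p v σ) (hp : 1 < p) (hr : 0 < r)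
    (hrp : r < p) :
    ∃ K : ℝ≥0∞, K ≠ ∞ ∧ ∀ u h : ℝ → ℝ≥0∞, Measurable u → Measurable h →
      ∀ y, 0 < y → copson u y ≠ ∞ →
      ∫⁻ t in Ioi y, hardy h t ^ r * u t ≤
        K * (∫⁻ t in Ioi y, copson u t ^ (r / (p - r)) * u t *
            hardy σ t ^ ((p - 1) * r / (p - r))) ^ ((p - r) / p) *
          (∫⁻ t in Ioi (0 : ℝ), h t ^ p * v t) ^ (r / p) := by
  obtain ⟨K, hK, hKu⟩ := D.hardy_inequality_of_lt hp hr hrp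
  refine ⟨K, hK, fun u h hu hh y hy hut => ?_⟩
  have key : ∀ f g : ℝ → ℝ≥0∞, (∀ t ∈ Ioi y, f t = g t) → (∀ t ∉ Ioi y, f t = 0) →
      ∫⁻ t in Ioi (0 : ℝ), f t = ∫⁻ t in Ioi y, g t := by
    intro f g h1 h2
    have : f = (Ioi y).indicator g := by
      ext t
      by_cases ht : t ∈ Ioi y
      · rw [indicator_of_mem ht, h1 t ht]
      · rw [indicator_of_notMem ht, h2 t ht]
    rw [this, lintegral_indicator measurableSet_Ioi, Measure.restrict_restrict measurableSet_Ioi,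
      inter_eq_left.2 (Ioi_subset_Ioi hy.le)]
  have h1 := hKu ((Ioi y).indicator u) h (hu.indicator measurableSet_Ioi) hh
    (by rwa [copson_indicator_Ioi, max_eq_left hy.le])
  rw [key _ (fun t => hardy h t ^ r * u t) (fun t ht => by rw [indicator_of_mem ht])
    (fun t ht => by rw [indicator_of_notMem ht, mul_zero]),
    key _ (fun t => copson u t ^ (r / (p - r)) * u t * hardy σ t ^ ((p - 1) * r / (p - r)))
    (fun t ht => by
      rw [indicator_of_mem ht, copson_indicator_Ioi, max_eq_right (le_of_lt ht)])
    (fun t ht => by rw [indicator_of_notMem ht, mul_zero, zero_mul])] at h1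
  exact h1

lemma DualPair.exists_iterated_hardy_le (D : DualPair p v σ) (hp : 1 < p) (hr : 0 < r)
    (hrp : r < p) (hpq : p ≤ q) {u w : ℝ → ℝ≥0∞} (hu : Measurable u) (hw : Measurable w)
    (hu0 : ∀ᵐ x ∂volume.restrict (Ioi (0 : ℝ)), u x ≠ 0)
    (hw0 : ∀ᵐ x ∂volume.restrict (Ioi (0 : ℝ)), w x ≠ 0) {F G : ℝ≥0∞} (hFt : F ≠ ∞) (hGt : G ≠ ∞)
    (hF : ∀ x, 0 < x →
      copson (fun t => copson u t ^ (q / r) * w t) x ^ (1 / q) * hardy σ x ^ ((p - 1) / p) ≤ F)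
    (hG : ∀ y, 0 < y → hardy w y ^ (1 / q) *
      (∫⁻ t in Ioi y, copson u t ^ (r / (p - r)) * u t *
        hardy σ t ^ ((p - 1) * r / (p - r))) ^ ((p - r) / (p * r)) ≤ G) :
    ∃ C : ℝ≥0∞, C ≠ ∞ ∧ ∀ h : ℝ → ℝ≥0∞, Measurable h →
      ∫⁻ x in Ioi (0 : ℝ), (∫⁻ t in Ioi x, hardy h t ^ r * u t) ^ (q / r) * w x ≤
        C * (∫⁻ t in Ioi (0 : ℝ), h t ^ p * v t) ^ (q / p) := by
  have hp0 : 0 < p := by linarith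
  have hp1 : 0 < p - 1 := by linarith
  have hpr : 0 < p - r := by linarith
  have hq : 0 < q := hp0.trans_le hpq
  have hqr : 0 < q / r := by positivity
  have hufin : ∀ x, 0 < x → copson u x ≠ ∞ := by
    intro x hx
    refine copson_ne_top_of_copson_rpow_mul hw hw0 hqr (fun x hx htop => ?_) hx
    have := hF x hx
    rw [htop, ENNReal.top_rpow_of_pos (by positivity), ENNReal.top_mul] at this
    · exact hFt (top_le_iff.1 this)
    · simp [ENNReal.rpow_eq_zero_iff, D.hardy_ne_zero x hx, D.hardy_ne_top x]
  have hwfin : ∀ y, hardy w y ≠ ∞ := hardy_ne_top_of_hardy_rpow_mul hu hu0 hufin D.hardy_ne_top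
    D.hardy_ne_zero (by positivity) (by positivity) hGt hG
  have hwpos : ∀ y, 0 < y → hardy w y ≠ 0 := fun y hy => hardy_ne_zero_of_ae hw hw0 hy
  obtain ⟨K₁, hK₁, hK₁h⟩ := D.hardy_inequality_of_le hp hpq
  obtain ⟨K₂, hK₂, hK₂h⟩ := D.lintegral_Ioi_hardy_rpow_le hp hr hrp
  have htail : ∀ k : ℝ → ℝ≥0∞, Measurable k → ∀ y, 0 < y → ∫⁻ t in Ioi y, hardy k t ^ r * u t ≤
      (K₂ * G ^ r) * hardy w y ^ (-(r / q)) *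
        (∫⁻ t in Ioi (0 : ℝ), k t ^ p * v t) ^ (r / p) := by
    intro k hk y hy
    refine (hK₂h u k hu hk y hy (hufin y hy)).trans ?_
    have h1 := ENNReal.rpow_le_rpow (hG y hy) hr.le
    rw [ENNReal.mul_rpow_of_nonneg _ _ hr.le, ← ENNReal.rpow_mul, ← ENNReal.rpow_mul,
      one_div_mul_eq_div] at h1
    have e1 : (p - r) / (p * r) * r = (p - r) / p := by field_simp
    rw [e1] at h1
    rw [mul_assoc K₂ (G ^ r)]
    gcongr
    calc _ = (hardy w y ^ (r / q) * (∫⁻ t in Ioi y, copson u t ^ (r / (p - r)) * u t *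
            hardy σ t ^ ((p - 1) * r / (p - r))) ^ ((p - r) / p)) * hardy w y ^ (-(r / q)) := by
          rw [mul_right_comm, ← ENNReal.rpow_add _ _ (hwpos y hy) (hwfin y)]
          simp
      _ ≤ _ := by gcongr
  set c : ℝ≥0∞ := 2 ^ (q / r) * (2 ^ r) ^ (q / r) with hc
  have hct : c ≠ ∞ := by
    refine ENNReal.mul_ne_top (ENNReal.rpow_ne_top_of_nonneg hqr.le (by simp))
      (ENNReal.rpow_ne_top_of_nonneg hqr.le (ENNReal.rpow_ne_top_of_nonneg hr.le (by simp)))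
  refine ⟨c * (K₁ * (F + 1) ^ q + (2 * (K₂ * G ^ r)) ^ (q / r) * 2), ?_, fun h hh => ?_⟩
  · refine ENNReal.mul_ne_top hct (ENNReal.add_ne_top.2 ⟨ENNReal.mul_ne_top hK₁
      (ENNReal.rpow_ne_top_of_nonneg hq.le (by simp [hFt])), ENNReal.mul_ne_top
      (ENNReal.rpow_ne_top_of_nonneg hqr.le (ENNReal.mul_ne_top (by simp) (ENNReal.mul_ne_top hK₂
        (ENNReal.rpow_ne_top_of_nonneg hr.le hGt)))) (by simp)⟩)
  have hfirst := hK₁h (fun t => copson u t ^ (q / r) * w t) h (by fun_prop) hh (F + 1) (by simp)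
    (by simp [hFt]) fun x hx => (hF x hx).trans le_self_add
  have hsecond := lintegral_Ioi_rpow_lintegral_Ioc_le hp0 hr hpq hu hw D.measurable_left hh
    hwfin hwpos htail
  set ψ : ℝ → ℝ≥0∞ := fun x => ∫⁻ t in Ioi x, (∫⁻ s in Ioc x t, h s) ^ r * u t with hψ
  have hsplit : ∀ x, 0 < x → ∫⁻ t in Ioi x, hardy h t ^ r * u t ≤
      2 ^ r * (hardy h x ^ r * copson u x + ψ x) := by
    intro x hx
    have h2 : (2 : ℝ≥0∞) ^ r ≠ ∞ := ENNReal.rpow_ne_top_of_nonneg hr.le (by simp)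
    rw [hψ, copson, ← lintegral_const_mul _ hu, ← lintegral_add_left (by fun_prop),
      ← lintegral_const_mul' _ _ h2]
    refine setLIntegral_mono' measurableSet_Ioi fun t ht => ?_
    rw [← add_mul, ← mul_assoc, hardy, lintegral_Ioc_add hx.le (le_of_lt ht)]
    exact mul_le_mul' (ENNReal.add_rpow_le_two_rpow_mul _ _ hr.le) le_rfl
  calc _ ≤ ∫⁻ x in Ioi (0 : ℝ), c * (hardy h x ^ q * (copson u x ^ (q / r) * w x) +
          ψ x ^ (q / r) * w x) := by
        refine setLIntegral_mono' measurableSet_Ioi fun x hx => ?_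
        calc _ ≤ (2 ^ r * (hardy h x ^ r * copson u x + ψ x)) ^ (q / r) * w x := by
              gcongr; exact hsplit x hx
          _ ≤ ((2 ^ r) ^ (q / r) * (2 ^ (q / r) *
                ((hardy h x ^ r * copson u x) ^ (q / r) + ψ x ^ (q / r)))) * w x := by
              rw [ENNReal.mul_rpow_of_nonneg _ _ hqr.le]
              gcongr
              exact ENNReal.add_rpow_le_two_rpow_mul _ _ hqr.le
          _ = _ := by
              rw [ENNReal.mul_rpow_of_nonneg _ _ hqr.le, ← ENNReal.rpow_mul (hardy h x),
                mul_div_cancel₀ _ hr.ne']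
              ring
    _ = c * ((∫⁻ x in Ioi (0 : ℝ), hardy h x ^ q * (copson u x ^ (q / r) * w x)) +
          ∫⁻ x in Ioi (0 : ℝ), ψ x ^ (q / r) * w x) := by
        rw [lintegral_const_mul' _ _ hct, lintegral_add_left (by fun_prop)]
    _ ≤ _ := by
        refine (mul_le_mul' le_rfl (add_le_add hfirst hsecond)).trans (le_of_eq ?_)
        ring

end DualPair

theorem statement14 (p q r : ℝ) (hq : 0 < q) (hr : 0 < r) (hp : 1 < p) (hrp : r < p) (hpq : p ≤ q)
    (u w v : ℝ → ℝ≥0∞) (hu : IsWeight u) (hw : IsWeight w) (hv : IsWeight v)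
    (hvfin : ∀ x ∈ Ioi (0 : ℝ), (∫⁻ t in Ioc (0 : ℝ) x, v t ^ (1 - p / (p - 1))) < ∞) :
    (∃ C : ℝ≥0, 0 < C ∧ ∀ h : ℝ → ℝ≥0∞, Measurable h →
        (∫⁻ x in Ioi (0 : ℝ),
            (∫⁻ t in Ioi x, (∫⁻ s in Ioc (0 : ℝ) t, h s) ^ r * u t) ^ (q / r) * w x) ^
          (1 / q) ≤
          (C : ℝ≥0∞) * (∫⁻ t in Ioi (0 : ℝ), h t ^ p * v t) ^ (1 / p)) ↔
      ((⨆ x ∈ Ioi (0 : ℝ),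
        (∫⁻ t in Ioi x, (∫⁻ s in Ioi t, u s) ^ (q / r) * w t) ^ (1 / q) *
          (∫⁻ t in Ioc (0 : ℝ) x, v t ^ (1 - p / (p - 1))) ^ ((p - 1) / p)) < ∞ ∧
      (⨆ t ∈ Ioi (0 : ℝ),
        (∫⁻ s in Ioc (0 : ℝ) t, w s) ^ (1 / q) *
          (∫⁻ x in Ioi t,
              (∫⁻ s in Ioi x, u s) ^ (r / (p - r)) * u x *
                (∫⁻ s in Ioc (0 : ℝ) x, v s ^ (1 - p / (p - 1))) ^ ((p - 1) * r / (p - r))) ^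
            ((p - r) / (p * r))) < ∞) := by
  have hp0 : 0 < p := by linarith
  have hp1 : 0 < p - 1 := by linarith
  have hpr : 0 < p - r := by linarith
  have hu0 : ∀ᵐ x ∂volume.restrict (Ioi (0 : ℝ)), u x ≠ 0 := hu.2.mono fun x hx => hx.1.ne'
  have hut : ∀ᵐ x ∂volume.restrict (Ioi (0 : ℝ)), u x ≠ ∞ := hu.2.mono fun x hx => hx.2.ne
  have hw0 : ∀ᵐ x ∂volume.restrict (Ioi (0 : ℝ)), w x ≠ 0 := hw.2.mono fun x hx => hx.1.ne'
  have hv0 : ∀ᵐ x ∂volume.restrict (Ioi (0 : ℝ)), v x ≠ 0 ∧ v x ≠ ∞ :=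
    hv.2.mono fun x hx => ⟨hx.1.ne', hx.2.ne⟩
  have hvm := hv.1
  have D : DualPair p v (fun t => v t ^ (1 - p / (p - 1))) := by
    have hσ : Measurable fun t => v t ^ (1 - p / (p - 1)) := by fun_prop
    refine ⟨hvm, hσ, hv0, fun _ => rfl, fun x => ?_, fun x hx => ?_⟩
    · rcases le_or_gt x 0 with hx | hx
      · simp [hardy, Ioc_eq_empty (not_lt.2 hx)]
      · exact (hvfin x hx).ne
    · refine hardy_ne_zero_of_ae hσ (hv0.mono fun t ht => ?_) hx
      simp [ENNReal.rpow_eq_zero_iff, ht.1, ht.2]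
  constructor
  · rintro ⟨C, hC0, hC⟩
    have hF := fun x hx => D.copson_rpow_mul_le hp hq hr hu.1 hw.1 hC (x := x) hx
    have hufin : ∀ x, 0 < x → copson u x ≠ ∞ := by
      intro x hx
      refine copson_ne_top_of_copson_rpow_mul hw.1 hw0 (e := q / r) (by positivity)
        (fun x hx htop => ?_) hx
      have := hF x hx
      rw [htop, ENNReal.top_rpow_of_pos (by positivity), ENNReal.top_mul] at this
      · exact ENNReal.coe_ne_top (top_le_iff.1 this)
      · simp [ENNReal.rpow_eq_zero_iff, D.hardy_ne_zero x hx, D.hardy_ne_top x]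
    obtain ⟨G, hGt, hG⟩ := D.exists_hardy_rpow_mul_le hp hq hr hrp hu.1 hw.1 hut hufin
      (by exact_mod_cast hC0.ne') ENNReal.coe_ne_top hC
    exact ⟨(iSup₂_le hF).trans_lt ENNReal.coe_lt_top, (iSup₂_le hG).trans_lt hGt.lt_top⟩
  · rintro ⟨hF, hG⟩
    obtain ⟨C, hCt, hC⟩ := D.exists_iterated_hardy_le hp hr hrp hpq hu.1 hw.1 hu0 hw0 hF.ne hG.ne
      (fun x hx => le_iSup₂ (α := ℝ≥0∞) (f := fun x (_ : x ∈ Ioi (0 : ℝ)) => _) x hx)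
      (fun x hx => le_iSup₂ (α := ℝ≥0∞) (f := fun x (_ : x ∈ Ioi (0 : ℝ)) => _) x hx)
    have hCq : C ^ (1 / q) ≠ ∞ := ENNReal.rpow_ne_top_of_nonneg (by positivity) hCt
    refine ⟨(C ^ (1 / q)).toNNReal + 1, by positivity, fun h hh => ?_⟩
    refine (ENNReal.rpow_le_rpow (hC h hh) (by positivity : 0 ≤ 1 / q)).trans ?_
    have e1 : q / p * (1 / q) = 1 / p := by field_simp
    rw [ENNReal.mul_rpow_of_nonneg _ _ (by positivity), ← ENNReal.rpow_mul, e1,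
      ENNReal.coe_add, ENNReal.coe_toNNReal hCq]
    gcongr
    exact le_self_add
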